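/- arXiv:1108.5708 — 7 statements merged into one kernel-verified Lean document; each statement's English description precedes it below -/
import Mathlib

section
/- Let R be a local Noetherian commutative ring of Krull dimension one. Then there exists a positive integer n such that every indecomposable injective R-module E has Malcev rank at most n, i.e., every finitely generated submodule of E can be generated by at most n elements. -/
open DirectSum


universe u v

/-- `gen M ≤ n`: `M` is generated by at most `n` elements. -/
def GenLE (R : Type u) [Semiring R] (M : Type v) [AddCommMonoid M] [Module R M] (n : ℕ) : Prop :=
  ∃ s : Finset M, s.card ≤ n ∧ Submodule.span R (s : Set M) = ⊤

/-- The Malcev rank of `M` is at most `n`: every finitely generated submodule of `M`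
is generated by at most `n` elements. -/
def MalcevRankLE (R : Type u) [Semiring R] (M : Type v) [AddCommMonoid M] [Module R M]
    (n : ℕ) : Prop :=
  ∀ X : Submodule R M, X.FG →
    ∃ s : Finset M, (s : Set M) ⊆ (X : Set M) ∧ s.card ≤ n ∧ Submodule.span R (s : Set M) = X

/-- An indecomposable (nonzero) module. -/
def IsIndecomposable (R : Type u) [Semiring R] (M : Type v) [AddCommMonoid M] [Module R M] :
    Prop :=
  (∃ x : M, x ≠ 0) ∧ ¬∃ A B : Submodule R M, A ≠ ⊥ ∧ B ≠ ⊥ ∧ IsCompl A B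

/-- A uniform module. -/
def IsUniformModule (R : Type u) [Semiring R] (M : Type v) [AddCommMonoid M] [Module R M] :
    Prop :=
  (∃ x : M, x ≠ 0) ∧ ∀ A B : Submodule R M, A ≠ ⊥ → B ≠ ⊥ → A ⊓ B ≠ ⊥

/-- A pure submodule: tensoring with any module preserves injectivity of the inclusion. -/
def IsPureSubmodule (R : Type u) [CommRing R] {M : Type v} [AddCommGroup M] [Module R M]
    (A : Submodule R M) : Prop :=
  ∀ (C : Type (max u v)) [AddCommGroup C] [Module R C],
    Function.Injective (LinearMap.rTensor C A.subtype)

/-- A uniserial module: submodules are totally ordered. -/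
def IsUniserialModule (R : Type u) [Semiring R] (M : Type v) [AddCommMonoid M] [Module R M] :
    Prop :=
  ∀ A B : Submodule R M, A ≤ B ∨ B ≤ A

/-- A polyserial module: it has a pure-composition series with uniserial factors. -/
def IsPolyserial (R : Type u) [CommRing R] (M : Type v) [AddCommGroup M] [Module R M] : Prop :=
  ∃ (n : ℕ) (F : Fin (n + 1) → Submodule R M),
    F 0 = ⊥ ∧ F (Fin.last n) = ⊤ ∧ StrictMono F ∧
    (∀ i, IsPureSubmodule R (F i)) ∧
    ∀ i : Fin n,
      IsUniserialModule R (↥(F i.succ) ⧸ Submodule.comap (F i.succ).subtype (F i.castSucc))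

/-- A pure-injective module. -/
def IsPureInjective (R : Type u) [CommRing R] (F : Type v) [AddCommGroup F] [Module R F] :
    Prop :=
  ∀ (B : Type (max u v)) [AddCommGroup B] [Module R B] (A : Submodule R B),
    IsPureSubmodule R A → ∀ f : A →ₗ[R] F, ∃ g : B →ₗ[R] F, ∀ a : A, g a = f a

/-- `B` is a pure-essential extension of its submodule `A`. -/
def IsPureEssentialExtension (R : Type u) [CommRing R] {B : Type v} [AddCommGroup B]
    [Module R B] (A : Submodule R B) : Prop :=
  IsPureSubmodule R A ∧
  ∀ K : Submodule R B, K ⊓ A = ⊥ → IsPureSubmodule R (A.map K.mkQ) → K = ⊥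

/-- A maximal ring: every finitely solvable family of congruences is solvable. -/
def IsMaximalCR (R : Type u) [CommRing R] : Prop :=
  ∀ (ι : Type u) (a : ι → R) (A : ι → Ideal R),
    (∀ s : Finset ι, ∃ x : R, ∀ i ∈ s, x - a i ∈ A i) → ∃ x : R, ∀ i, x - a i ∈ A i

/-- An almost maximal ring. -/
def IsAlmostMaximalCR (R : Type u) [CommRing R] : Prop :=
  ∀ (ι : Type u) (a : ι → R) (A : ι → Ideal R), (⨅ i, A i) ≠ ⊥ →
    (∀ s : Finset ι, ∃ x : R, ∀ i ∈ s, x - a i ∈ A i) → ∃ x : R, ∀ i, x - a i ∈ A i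

/-- `M_♯`, the bottom prime ideal associated with `M`, as a set. -/
def sharpSet (R : Type u) [CommRing R] (M : Type v) [AddCommGroup M] [Module R M] : Set R :=
  {s : R | ∃ x : M, x ≠ 0 ∧ s • x = 0}

/-- The set of zero-divisors of `R`. -/
def zeroDivisorsSet (R : Type u) [CommRing R] : Set R :=
  {r : R | ∃ s : R, s ≠ 0 ∧ r * s = 0}

/-- Finite Goldie dimension: every independent family of nonzero submodules is finite. -/
def HasFiniteGoldieDimension (R : Type u) [Semiring R] (M : Type v) [AddCommMonoid M]
    [Module R M] : Prop :=
  ∀ (ι : Type v) (f : ι → Submodule R M), (∀ i, f i ≠ ⊥) →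
    (∀ i, f i ⊓ (⨆ j : {j : ι // j ≠ i}, f j.1) = ⊥) → Finite ι

/-- A superfluous (small) submodule. -/
def IsSuperfluous {R : Type u} [Semiring R] {M : Type v} [AddCommMonoid M] [Module R M]
    (K : Submodule R M) : Prop :=
  ∀ G : Submodule R M, K ⊔ G = ⊤ → G = ⊤

/-- A co-uniform (hollow) module. -/
def IsCouniform (R : Type u) [Semiring R] (M : Type v) [AddCommMonoid M] [Module R M] : Prop :=
  (∃ x : M, x ≠ 0) ∧ ∀ K : Submodule R M, K ≠ ⊤ → IsSuperfluous K

/-- An essential submodule. -/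
def IsEssentialSubmodule {R : Type u} [Semiring R] {M : Type v} [AddCommMonoid M] [Module R M]
    (A : Submodule R M) : Prop :=
  ∀ K : Submodule R M, K ⊓ A = ⊥ → K = ⊥

/-- `M` has dual Goldie dimension `n`. -/
def HasDualGoldieDim (R : Type u) [Ring R] (M : Type v) [AddCommGroup M] [Module R M]
    (n : ℕ) : Prop :=
  ∃ (N : Fin n → Type v) (hab : ∀ i, AddCommGroup (N i)),
    letI := hab
    ∃ hmod : ∀ i, Module R (N i),
      letI := hmod
      ∃ φ : M →ₗ[R] ⨁ i, N i,
        Function.Surjective φ ∧ IsSuperfluous (LinearMap.ker φ) ∧ ∀ i, IsCouniform R (N i)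


section Length

open scoped Pointwise

variable {R : Type*} [CommRing R] {M N P : Type*} [AddCommGroup M] [AddCommGroup N]
  [AddCommGroup P] [Module R M] [Module R N] [Module R P]

theorem Module.length_le_add_of_exact (f : N →ₗ[R] M) (g : M →ₗ[R] P)
    (H : Function.Exact f g) :
    Module.length R M ≤ Module.length R N + Module.length R P := by
  rw [Module.length_eq_add_of_exact (LinearMap.range f).subtype (LinearMap.range f).mkQ
    (Submodule.subtype_injective _) (Submodule.mkQ_surjective _)
    (LinearMap.exact_subtype_mkQ _)]
  refine add_le_add (Module.length_le_of_surjective f.rangeRestrict f.surjective_rangeRestrict) ?_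
  refine Module.length_le_of_injective ((LinearMap.range f).liftQ g ?_) ?_
  · exact (LinearMap.exact_iff.mp H).ge
  · rw [← LinearMap.ker_eq_bot, Submodule.ker_liftQ_eq_bot']
    exact (LinearMap.exact_iff.mp H).symm

theorem exists_finset_card_le_sup_span_eq_top (K : Submodule R M) (t : Finset (M ⧸ K))
    (ht : Submodule.span R (t : Set (M ⧸ K)) = ⊤) :
    ∃ s : Finset M, s.card ≤ t.card ∧ K ⊔ Submodule.span R (s : Set M) = ⊤ := by
  classical
  refine ⟨t.image Quotient.out, Finset.card_image_le, ?_⟩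
  rw [← Submodule.map_mkQ_eq_top, Submodule.map_span, ← ht]
  congr 1
  ext z
  simp only [Finset.coe_image, Set.image_image, Set.mem_image]
  constructor
  · rintro ⟨w, hw, rfl⟩
    rwa [show K.mkQ w.out = w from Quotient.out_eq w]
  · exact fun hz => ⟨z, hz, Quotient.out_eq z⟩

/-- A module of length at most `n` is generated by at most `n` elements. -/
theorem exists_finset_card_le_span_eq_top_of_length_le (n : ℕ) (h : Module.length R M ≤ n) :
    ∃ s : Finset M, s.card ≤ n ∧ Submodule.span R (s : Set M) = ⊤ := by
  classical
  induction n generalizing M with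
  | zero =>
    have : Subsingleton M := Module.length_eq_zero_iff.mp (by simpa using h)
    exact ⟨∅, by simp, Subsingleton.elim _ _⟩
  | succ n ih =>
    rcases subsingleton_or_nontrivial M with hM | hM
    · exact ⟨∅, by simp, Subsingleton.elim _ _⟩
    obtain ⟨y, hy⟩ := exists_ne (0 : M)
    have hfl := isFiniteLength_iff_isNoetherian_isArtinian.mp
      (Module.length_ne_top_iff.mp (ne_top_of_le_ne_top (ENat.natCast_ne_top _) h))
    have := hfl.1
    have := hfl.2
    have hlt := Submodule.length_quotient_lt (Submodule.span R {y})
      (by simpa [Submodule.span_singleton_eq_bot] using hy)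
    obtain ⟨t, htc, ht⟩ := ih (M := M ⧸ Submodule.span R {y})
      (ENat.lt_natCast_add_one_iff.mp (by simpa using hlt.trans_le h))
    obtain ⟨s, hsc, hs⟩ := exists_finset_card_le_sup_span_eq_top _ t ht
    refine ⟨insert y s, (Finset.card_insert_le _ _).trans (Nat.succ_le_succ (hsc.trans htc)), ?_⟩
    rwa [Finset.coe_insert, Submodule.span_insert]

/-- If `M / xM` has length at most `n`, with `x` in the maximal ideal of a local ring and `M`
finitely generated, then `M` is generated by at most `n` elements. -/
theorem exists_finset_card_le_span_eq_top_of_length_quotSMulTop_le [IsLocalRing R]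
    [Module.Finite R M] {x : R} (hx : x ∈ IsLocalRing.maximalIdeal R) (n : ℕ)
    (h : Module.length R (QuotSMulTop x M) ≤ n) :
    ∃ s : Finset M, s.card ≤ n ∧ Submodule.span R (s : Set M) = ⊤ := by
  obtain ⟨t, htc, ht⟩ := exists_finset_card_le_span_eq_top_of_length_le n h
  obtain ⟨s, hsc, hs⟩ := exists_finset_card_le_sup_span_eq_top _ t ht
  refine ⟨s, hsc.trans htc, top_le_iff.mp ?_⟩
  refine Submodule.le_of_le_smul_of_le_jacobson_bot (I := Ideal.span {x}) Module.Finite.fg_top ?_ ?_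
  · exact ((Ideal.span_singleton_le_iff_mem _).mpr hx).trans
      (IsLocalRing.maximalIdeal_le_jacobson _)
  · rw [Submodule.ideal_span_singleton_smul, sup_comm, hs]

theorem length_quotSMulTop_le_add (x : R) (f : N →ₗ[R] M) (g : M →ₗ[R] P)
    (H : Function.Exact f g) (hg : Function.Surjective g) :
    Module.length R (QuotSMulTop x M) ≤
      Module.length R (QuotSMulTop x N) + Module.length R (QuotSMulTop x P) :=
  Module.length_le_add_of_exact _ _ (QuotSMulTop.map_exact x H hg)

theorem length_quotSMulTop_le_of_length_quotient_ne_top (x : R) (I : Submodule R M)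
    (hI : Module.length R (M ⧸ I) ≠ ⊤) :
    Module.length R (QuotSMulTop x I) ≤ Module.length R (QuotSMulTop x M) := by
  let J : Submodule R M := x • I
  have hJI : J ≤ I := Submodule.smul_le_self_of_tower x I
  have hmem : I ≤ J.comap (LinearMap.lsmul R M x) :=
    fun m hm => Submodule.smul_mem_pointwise_smul m x I hm
  have e1 : Module.length R (M ⧸ J) =
      Module.length R (QuotSMulTop x I) + Module.length R (M ⧸ I) := by
    refine Module.length_eq_add_of_exact
      (Submodule.mapQ (x • (⊤ : Submodule R I)) J I.subtype ?_)
      (Submodule.factor hJI) ?_ (Submodule.factor_surjective hJI) ?_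
    · intro m hm
      obtain ⟨k, -, rfl⟩ := (Submodule.mem_smul_pointwise_iff_exists m x _).mp hm
      exact Submodule.smul_mem_pointwise_smul _ x I k.2
    · rw [injective_iff_map_eq_zero]
      intro a ha
      obtain ⟨a, rfl⟩ := Submodule.Quotient.mk_surjective _ a
      rw [Submodule.mapQ_apply, Submodule.Quotient.mk_eq_zero] at ha
      obtain ⟨k, hk, hk'⟩ := (Submodule.mem_smul_pointwise_iff_exists _ x _).mp ha
      rw [Submodule.Quotient.mk_eq_zero]
      have : a = x • (⟨k, hk⟩ : I) := Subtype.ext hk'.symm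
      rw [this]
      exact Submodule.smul_mem_pointwise_smul _ x _ trivial
    · intro b
      obtain ⟨b, rfl⟩ := Submodule.Quotient.mk_surjective _ b
      constructor
      · intro hb
        have hb : b ∈ I := by simpa [Submodule.factor] using hb
        exact ⟨Submodule.Quotient.mk ⟨b, hb⟩, rfl⟩
      · rintro ⟨a, ha⟩
        obtain ⟨a, rfl⟩ := Submodule.Quotient.mk_surjective _ a
        rw [← ha, Submodule.mapQ_apply]
        simp [Submodule.factor]
  have e2 : Module.length R (M ⧸ J) ≤
      Module.length R (M ⧸ I) + Module.length R (QuotSMulTop x M) := by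
    have hJ : J ≤ x • (⊤ : Submodule R M) := by
      intro m hm
      obtain ⟨k, -, rfl⟩ := (Submodule.mem_smul_pointwise_iff_exists m x _).mp hm
      exact Submodule.smul_mem_pointwise_smul _ x _ trivial
    refine Module.length_le_add_of_exact
      (Submodule.mapQ I J (LinearMap.lsmul R M x) hmem) (Submodule.factor hJ) ?_
    intro b
    obtain ⟨b, rfl⟩ := Submodule.Quotient.mk_surjective _ b
    constructor
    · intro hb
      have hb : b ∈ x • (⊤ : Submodule R M) := by simpa [Submodule.factor] using hb
      obtain ⟨k, -, rfl⟩ := (Submodule.mem_smul_pointwise_iff_exists _ x _).mp hb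
      exact ⟨Submodule.Quotient.mk k, rfl⟩
    · rintro ⟨a, ha⟩
      obtain ⟨a, rfl⟩ := Submodule.Quotient.mk_surjective _ a
      rw [← ha, Submodule.mapQ_apply]
      have : x • a ∈ x • (⊤ : Submodule R M) := Submodule.smul_mem_pointwise_smul a x ⊤ trivial
      exact (Submodule.Quotient.mk_eq_zero _).mpr this
  rw [e1, add_comm] at e2
  exact (ENat.add_le_add_iff_left hI).mp e2

theorem length_quotSMulTop_eq_length_ker (x : R) (hM : Module.length R M ≠ ⊤) :
    Module.length R (QuotSMulTop x M) =
      Module.length R (QuotSMulTop x (LinearMap.ker (LinearMap.lsmul R M x))) := by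
  set f := LinearMap.lsmul R M x with hf
  have hker : x • (⊤ : Submodule R (LinearMap.ker f)) = ⊥ := by
    rw [eq_bot_iff]
    intro m hm
    obtain ⟨k, -, rfl⟩ := (Submodule.mem_smul_pointwise_iff_exists m x _).mp hm
    exact Subtype.ext k.2
  have hrange : LinearMap.range f = x • (⊤ : Submodule R M) := by
    rw [LinearMap.range_eq_map]; rfl
  rw [(Submodule.quotEquivOfEqBot _ hker).length_eq]
  have e1 := Module.length_eq_add_of_exact (LinearMap.ker f).subtype f.rangeRestrict
    (Submodule.subtype_injective _) f.surjective_rangeRestrict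
    (by rw [LinearMap.exact_iff, LinearMap.ker_rangeRestrict, Submodule.range_subtype])
  have e2 := Module.length_eq_add_of_exact (LinearMap.range f).subtype (LinearMap.range f).mkQ
    (Submodule.subtype_injective _) (Submodule.mkQ_surjective _)
    (LinearMap.exact_subtype_mkQ _)
  have hr : Module.length R (LinearMap.range f) ≠ ⊤ :=
    ne_top_of_le_ne_top hM (e2 ▸ le_self_add)
  rw [e1, add_comm, (ENat.addLECancellable_of_ne_top hr).inj] at e2
  rw [e2, hrange]

theorem length_ne_top_of_primes_isMaximal [IsNoetherianRing R] [Module.Finite R M] (J : Ideal R)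
    (hJ : ∀ q : Ideal R, q.IsPrime → J ≤ q → q.IsMaximal)
    (hM : ∀ a ∈ J, ∀ m : M, a • m = 0) : Module.length R M ≠ ⊤ := by
  have : Ring.KrullDimLE 0 (R ⧸ J) := Ring.krullDimLE_zero_iff.mpr fun q hq => by
    have hs := Ideal.Quotient.mk_surjective (I := J)
    have hm := hJ _ (Ideal.comap_isPrime (Ideal.Quotient.mk J) q) (by
      intro a ha
      simp [Ideal.mem_comap, Ideal.Quotient.eq_zero_iff_mem.mpr ha])
    have := Ideal.map_eq_top_or_isMaximal_of_surjective _ hs hm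
    rw [Ideal.map_comap_of_surjective _ hs] at this
    exact this.resolve_left hq.ne_top
  have : IsArtinianRing (R ⧸ J) :=
    isArtinianRing_iff_isNoetherianRing_krullDimLE_zero.mpr ⟨inferInstance, this⟩
  have htor : Module.IsTorsionBySet R M J := fun m a => hM a a.2 m
  let _ : Module (R ⧸ J) M := htor.module
  have : IsScalarTower R (R ⧸ J) M := htor.isScalarTower
  have : Module.Finite (R ⧸ J) M := Module.Finite.of_restrictScalars_finite R (R ⧸ J) M
  have : IsArtinian R M :=
    (isArtinian_of_surjective_algebraMap (R := R ⧸ J) Ideal.Quotient.mk_surjective)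
  exact Module.length_ne_top

theorem length_quotSMulTop_self_ne_top [IsNoetherianRing R] {x : R}
    (hmax : ∀ q : Ideal R, q.IsPrime → x ∈ q → q.IsMaximal) :
    Module.length R (QuotSMulTop x R) ≠ ⊤ := by
  refine length_ne_top_of_primes_isMaximal (Ideal.span {x})
    (fun q hq hle => hmax q hq (hle (Ideal.mem_span_singleton_self x))) fun a ha m => ?_
  obtain ⟨m, rfl⟩ := Submodule.Quotient.mk_surjective _ m
  obtain ⟨b, rfl⟩ := Ideal.mem_span_singleton.mp ha
  rw [← Submodule.Quotient.mk_smul, Submodule.Quotient.mk_eq_zero, mul_smul]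
  exact Submodule.smul_mem_pointwise_smul _ x ⊤ trivial

end Length

section BoundedQuotient

/-- Every finitely generated submodule `X` of `M` satisfies `length (X / xX) ≤ n`. -/
def QuotSMulTopLengthLE (R : Type*) [CommRing R] (x : R) (M : Type*) [AddCommGroup M]
    [Module R M] (n : ℕ∞) : Prop :=
  ∀ X : Submodule R M, X.FG → Module.length R (QuotSMulTop x X) ≤ n

variable {R : Type*} [CommRing R] {x : R} {M N P : Type*} [AddCommGroup M] [AddCommGroup N]
  [AddCommGroup P] [Module R M] [Module R N] [Module R P]

theorem QuotSMulTopLengthLE.length_le {n : ℕ∞} (h : QuotSMulTopLengthLE R x M n)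
    [Module.Finite R N] (f : N →ₗ[R] M) (hf : Function.Injective f) :
    Module.length R (QuotSMulTop x N) ≤ n := by
  rw [(QuotSMulTop.congr x (LinearEquiv.ofInjective f hf)).length_eq]
  exact h _ (Module.Finite.iff_fg.mp inferInstance)

theorem QuotSMulTopLengthLE.of_injective {n : ℕ∞} (h : QuotSMulTopLengthLE R x M n)
    (f : N →ₗ[R] M) (hf : Function.Injective f) : QuotSMulTopLengthLE R x N n := fun X hX =>
  have := Module.Finite.iff_fg.mpr hX
  h.length_le (f ∘ₗ X.subtype) (hf.comp X.subtype_injective)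

theorem QuotSMulTopLengthLE.of_ker [IsNoetherianRing R] {a b : ℕ∞} (g : M →ₗ[R] P)
    (ha : QuotSMulTopLengthLE R x (LinearMap.ker g) a) (hb : QuotSMulTopLengthLE R x P b) :
    QuotSMulTopLengthLE R x M (a + b) := by
  intro X hX
  have := Module.Finite.iff_fg.mpr hX
  set h := g ∘ₗ X.subtype with hh
  refine (length_quotSMulTop_le_add x (LinearMap.ker h).subtype h.rangeRestrict
    (by rw [LinearMap.exact_iff, LinearMap.ker_rangeRestrict, Submodule.range_subtype])
    h.surjective_rangeRestrict).trans (add_le_add ?_ ?_)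
  · refine ha.length_le ((X.subtype ∘ₗ (LinearMap.ker h).subtype).codRestrict _ fun c => c.2) ?_
    intro c d hcd
    exact Subtype.ext (Subtype.ext (Subtype.ext_iff.mp hcd :))
  · exact hb.length_le (LinearMap.range h).subtype (Submodule.subtype_injective _)

theorem QuotSMulTopLengthLE.of_subsingleton [Subsingleton M] : QuotSMulTopLengthLE R x M 0 :=
  fun _ _ => by simp

theorem QuotSMulTopLengthLE.pi_fin [IsNoetherianRing R] {a : ℕ∞}
    (ha : QuotSMulTopLengthLE R x M a) (k : ℕ) :
    QuotSMulTopLengthLE R x (Fin k → M) (k * a) := by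
  induction k with
  | zero => simpa using QuotSMulTopLengthLE.of_subsingleton (R := R) (x := x) (M := Fin 0 → M)
  | succ k ih =>
    rw [Nat.cast_succ, add_mul, one_mul]
    refine .of_ker (LinearMap.proj 0) (ih.of_injective
      (LinearMap.funLeft R M Fin.succ ∘ₗ Submodule.subtype _) ?_) ha
    intro c d hcd
    ext i
    refine Fin.cases ?_ (fun i => congrFun hcd i) i
    exact (LinearMap.mem_ker.mp c.2).trans (LinearMap.mem_ker.mp d.2).symm

theorem exists_quotSMulTopLengthLE_torsionBySet_pow [IsNoetherianRing R] (x : R) (p : Ideal R)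
    (e i : ℕ) : ∃ C : ℕ, ∀ (E : Type u) [AddCommGroup E] [Module R E],
      QuotSMulTopLengthLE R x (Submodule.torsionBySet R E p) e →
      QuotSMulTopLengthLE R x (Submodule.torsionBySet R E (p ^ i : Ideal R)) C := by
  induction i with
  | zero =>
    refine ⟨0, fun E _ _ _ => ?_⟩
    have : Subsingleton (Submodule.torsionBySet R E (p ^ 0 : Ideal R)) := by
      refine ⟨fun c d => Subtype.ext ?_⟩
      have hc := (Submodule.mem_torsionBySet_iff _ _).mp c.2 ⟨1, by simp⟩
      have hd := (Submodule.mem_torsionBySet_iff _ _).mp d.2 ⟨1, by simp⟩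
      simpa using hc.trans hd.symm
    exact .of_subsingleton
  | succ i ih =>
    obtain ⟨C, hC⟩ := ih
    obtain ⟨k, s, hs⟩ := Submodule.fg_iff_exists_fin_generating_family.mp
      (IsNoetherian.noetherian p)
    have hsp : ∀ j, s j ∈ p := fun j => hs ▸ Submodule.subset_span ⟨j, rfl⟩
    refine ⟨e + k * C, fun E _ _ hE => ?_⟩
    let g : Submodule.torsionBySet R E (p ^ (i + 1) : Ideal R) →ₗ[R]
        (Fin k → Submodule.torsionBySet R E (p ^ i : Ideal R)) :=
      LinearMap.pi fun j => (LinearMap.lsmul R E (s j) ∘ₗ Submodule.subtype _).codRestrict _ <| by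
        intro c
        rw [Submodule.mem_torsionBySet_iff]
        rintro ⟨a, ha⟩
        have := (Submodule.mem_torsionBySet_iff _ _).mp c.2
          ⟨a * s j, by rw [pow_succ]; exact Ideal.mul_mem_mul ha (hsp j)⟩
        simpa [mul_smul] using this
    have key := QuotSMulTopLengthLE.of_ker (x := x) (a := e) g (hE.of_injective
      ((Submodule.subtype _ ∘ₗ Submodule.subtype _).codRestrict _ ?_) ?_) ((hC E hE).pi_fin k)
    · exact_mod_cast key
    · intro c
      rw [Submodule.mem_torsionBySet_iff]
      rintro ⟨a, ha⟩
      have ha' : a ∈ Submodule.span R (Set.range s) := hs ▸ ha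
      change a • (c : E) = 0
      clear ha
      induction ha' using Submodule.span_induction with
      | mem a ha =>
        obtain ⟨j, rfl⟩ := ha
        exact congrArg Subtype.val (congrFun (LinearMap.mem_ker.mp c.2) j)
      | zero => simp
      | add a b _ _ ha hb => rw [add_smul, ha, hb, add_zero]
      | smul r a _ ha => rw [smul_assoc, ha, smul_zero]
    · intro c d hcd
      exact Subtype.ext (Subtype.ext (Subtype.ext_iff.mp hcd :))

end BoundedQuotient

section Uniform

theorem IsUniformModule.exists_mem_inf {R : Type*} [CommRing R] {E : Type*} [AddCommGroup E]
    [Module R E] (hE : IsUniformModule R E) {y z : E} (hy : y ≠ 0) (hz : z ≠ 0) :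
    ∃ a b : R, a • y = b • z ∧ b • z ≠ 0 := by
  have := hE.2 (Submodule.span R {y}) (Submodule.span R {z})
    (by simpa using hy) (by simpa using hz)
  obtain ⟨w, ⟨hw1, hw2⟩, hw⟩ := Submodule.exists_mem_ne_zero_of_ne_bot this
  obtain ⟨a, ha⟩ := Submodule.mem_span_singleton.mp hw1
  obtain ⟨b, hb⟩ := Submodule.mem_span_singleton.mp hw2
  exact ⟨a, b, ha.trans hb.symm, hb ▸ hw⟩

variable {R : Type*} [CommRing R] {E : Type*} [AddCommGroup E] [Module R E]
  {p : Ideal R}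

theorem IsUniformModule.eq_zero_of_smul_eq_zero (hE : IsUniformModule R E) (hp : p.IsPrime)
    {u : E} (hu : ∀ r : R, r • u = 0 ↔ r ∈ p) {s : R} (hs : s ∉ p) {y : E} (h : s • y = 0) :
    y = 0 := by
  by_contra hy
  have hu0 : u ≠ 0 := fun h => hp.one_notMem ((hu 1).mp (by simpa using h))
  obtain ⟨a, b, hab, hb⟩ := hE.exists_mem_inf hy hu0
  have : s * b ∈ p := by
    rw [← hu, mul_smul, ← hab, smul_comm, h, smul_zero]
  exact hb ((hu b).mpr ((hp.mem_or_mem this).resolve_left hs))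

theorem IsUniformModule.exists_smul_mem_span_singleton (hE : IsUniformModule R E) (hp : p.IsPrime)
    {v : E} (hv : v ≠ 0)
    {X : Submodule R E} (hX : X.FG) (hXp : ∀ a ∈ p, ∀ y ∈ X, a • y = 0) :
    ∃ s ∉ p, ∀ y ∈ X, s • y ∈ Submodule.span R {v} := by
  classical
  have h1 : ∀ y ∈ X, ∃ s ∉ p, s • y ∈ Submodule.span R {v} := by
    intro y hyX
    by_cases hy : y = 0
    · exact ⟨1, hp.one_notMem, by simp [hy]⟩
    obtain ⟨a, b, hab, hb⟩ := hE.exists_mem_inf hy hv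
    refine ⟨a, fun ha => hb (hab ▸ hXp a ha y hyX), ?_⟩
    exact hab ▸ Submodule.smul_mem _ _ (Submodule.mem_span_singleton_self v)
  obtain ⟨t, rfl⟩ := hX
  have h2 : ∀ t' ⊆ t, ∃ s ∉ p, ∀ y ∈ t', s • y ∈ Submodule.span R {v} := by
    intro t' ht'
    induction t' using Finset.induction_on with
    | empty => exact ⟨1, hp.one_notMem, by simp⟩
    | insert y t' _ ih =>
      obtain ⟨s, hs, hst⟩ := ih ((Finset.subset_insert _ _).trans ht')
      obtain ⟨r, hr, hry⟩ := h1 y (Submodule.subset_span (ht' (Finset.mem_insert_self _ _)))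
      refine ⟨r * s, fun h => (hp.mem_or_mem h).elim hr hs, fun z hz => ?_⟩
      rcases Finset.mem_insert.mp hz with rfl | hz
      · rw [mul_comm, mul_smul]
        exact Submodule.smul_mem _ _ hry
      · rw [mul_smul]
        exact Submodule.smul_mem _ _ (hst z hz)
  obtain ⟨s, hs, hst⟩ := h2 t subset_rfl
  refine ⟨s, hs, fun y hy => ?_⟩
  have : Submodule.span R (t : Set E) ≤ (Submodule.span R {v}).comap (LinearMap.lsmul R E s) :=
    Submodule.span_le.mpr fun y hy => hst y hy
  exact this hy

theorem IsUniformModule.quotSMulTopLengthLE_torsionBySet [IsNoetherianRing R]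
    (hE : IsUniformModule R E) (hp : p.IsPrime)
    {u : E} (hu : ∀ r : R, r • u = 0 ↔ r ∈ p)
    (hmax : ∀ q : Ideal R, q.IsPrime → p < q → q.IsMaximal) (x : R) :
    QuotSMulTopLengthLE R x (Submodule.torsionBySet R E p)
      (Module.length R (QuotSMulTop x R)) := by
  intro X' hX'
  set X : Submodule R E := X'.map (Submodule.subtype _) with hX_def
  have hX : X.FG := hX'.map _
  have hXp : ∀ a ∈ p, ∀ y ∈ X, a • y = 0 := by
    rintro a ha _ ⟨y, -, rfl⟩
    exact (Submodule.mem_torsionBySet_iff _ _).mp y.2 ⟨a, ha⟩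
  rw [(QuotSMulTop.congr x (Submodule.equivMapOfInjective _
    (Submodule.subtype_injective (Submodule.torsionBySet R E p)) X')).length_eq]
  change Module.length R (QuotSMulTop x X) ≤ _
  by_cases hbot : X = ⊥
  · have : Subsingleton X := by rw [hbot]; infer_instance
    simp
  obtain ⟨v, hvX, hv⟩ := Submodule.exists_mem_ne_zero_of_ne_bot hbot
  obtain ⟨s, hs, hsX⟩ := hE.exists_smul_mem_span_singleton hp hv hX hXp
  let f : X →ₗ[R] Submodule.span R {v} :=
    (LinearMap.lsmul R E s ∘ₗ X.subtype).codRestrict _ fun y => hsX y y.2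
  have hf : Function.Injective f := by
    rw [injective_iff_map_eq_zero]
    intro y hy
    exact Subtype.ext
      (hE.eq_zero_of_smul_eq_zero hp hu hs (congrArg Subtype.val hy : s • (y : E) = 0))
  rw [(QuotSMulTop.congr x (LinearEquiv.ofInjective f hf)).length_eq]
  have hvX' : Submodule.span R {v} ≤ X := by simpa using hvX
  refine (length_quotSMulTop_le_of_length_quotient_ne_top x _ ?_).trans ?_
  · refine length_ne_top_of_primes_isMaximal (p ⊔ Ideal.span {s}) ?_ ?_
    · intro q hq hle
      refine hmax q hq (lt_of_le_of_ne (le_sup_left.trans hle) ?_)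
      rintro rfl
      exact hs (hle (Ideal.mem_sup_right (Ideal.mem_span_singleton_self s)))
    · intro a ha m
      obtain ⟨m, rfl⟩ := Submodule.Quotient.mk_surjective _ m
      obtain ⟨b, hb, c, hc, rfl⟩ := Submodule.mem_sup.mp ha
      obtain ⟨d, rfl⟩ := Ideal.mem_span_singleton'.mp hc
      rw [← Submodule.Quotient.mk_smul, Submodule.Quotient.mk_eq_zero, add_smul]
      have h0 : b • m = 0 := Subtype.ext (hXp b hb m (hvX' m.2))
      rw [h0, zero_add, mul_smul]
      exact Submodule.smul_mem _ _ ⟨⟨m, hvX' m.2⟩, rfl⟩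
  · let h : R →ₗ[R] Submodule.span R {v} :=
      (LinearMap.toSpanSingleton R E v).codRestrict _ fun r =>
        Submodule.smul_mem _ _ (Submodule.mem_span_singleton_self v)
    have hh : Function.Surjective h := fun w => by
      obtain ⟨r, hr⟩ := Submodule.mem_span_singleton.mp w.2
      exact ⟨r, Subtype.ext hr⟩
    exact Module.length_le_of_surjective _ (QuotSMulTop.map_surjective x hh)

theorem IsUniformModule.exists_pow_smul_eq_zero [IsNoetherianRing R]
    (hE : IsUniformModule R E) (hp : p.IsPrime)
    {u : E} (hu : ∀ r : R, r • u = 0 ↔ r ∈ p) {x : R} (hx : x ∈ p)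
    {X : Submodule R E} (hX : X.FG) : ∃ k : ℕ, ∀ y ∈ X, x ^ k • y = 0 := by
  have := isNoetherian_of_fg_of_noetherian X hX
  have hu0 : u ≠ 0 := fun h => hp.one_notMem ((hu 1).mp (by simpa using h))
  obtain ⟨n, hn⟩ := Filter.eventually_atTop.mp
    (Module.End.eventually_disjoint_ker_pow_range_pow (LinearMap.lsmul R X x))
  have hpow : ∀ z : X, ((LinearMap.lsmul R X x : Module.End R X) ^ (n + 1)) z = x ^ (n + 1) • z := by
    intro z
    rw [Module.End.pow_apply]
    exact smul_iterate_apply x (n + 1) z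
  refine ⟨n + 1, fun y hyX => ?_⟩
  by_contra hy
  obtain ⟨a, b, hab, hb⟩ := hE.exists_mem_inf hy hu0
  have hz := Submodule.disjoint_def.mp (hn (n + 1) (Nat.le_succ n))
    (a • x ^ (n + 1) • (⟨y, hyX⟩ : X)) ?_ ⟨a • (⟨y, hyX⟩ : X), ?_⟩
  · exact hb (hab.symm.trans (Subtype.ext_iff.mp hz))
  · rw [LinearMap.mem_ker, hpow]
    refine Subtype.ext ?_
    change x ^ (n + 1) • a • x ^ (n + 1) • y = 0
    rw [hab, pow_succ, mul_smul, smul_comm x b u, (hu x).mpr hx, smul_zero, smul_zero]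
  · rw [hpow, smul_comm]

end Uniform

section Injective

theorem IsIndecomposable.isUniformModule {R : Type u} [CommRing R] {E : Type u} [AddCommGroup E]
    [Module R E] (hE : IsIndecomposable R E) (hinj : Module.Injective R E) :
    IsUniformModule R E := by
  refine ⟨hE.1, fun A B hA hB hAB => hE.2 ?_⟩
  have hmax : ∀ S T : Submodule R E, Disjoint S T →
      ∃ S', S ≤ S' ∧ Maximal (fun S => Disjoint S T) S' := fun S T hST => by
    refine zorn_le_nonempty₀ {S | Disjoint S T} (fun c hc hchain y hy => ?_) S hST
    refine ⟨sSup c, ?_, fun z hz => le_sSup hz⟩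
    exact (DirectedOn.disjoint_sSup_left hchain.directedOn).mpr fun z hz => hc hz
  obtain ⟨C, hAC, hC⟩ := hmax A B (disjoint_iff.mpr hAB)
  obtain ⟨D, hBD, hD⟩ := hmax B C hC.prop.symm
  have hCD : Disjoint C D := hD.prop.symm
  refine ⟨C, D, fun h => hA (le_bot_iff.mp (h ▸ hAC)),
    fun h => hB (le_bot_iff.mp (h ▸ hBD)), hCD, ?_⟩
  obtain ⟨g, hg⟩ := hinj.out (C.subtype.coprod D.subtype) (by
    rw [← LinearMap.ker_eq_bot, LinearMap.ker_coprod_of_disjoint_range _ _ (by simpa using hCD)]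
    simp) (C.subtype ∘ₗ LinearMap.fst R C D)
  have hgC : ∀ c ∈ C, g c = c := fun c hc => by simpa using hg (⟨c, hc⟩, 0)
  have hgD : ∀ d ∈ D, g d = 0 := fun d hd => by simpa using hg (0, ⟨d, hd⟩)
  have hrange : LinearMap.range g ≤ C := by
    refine hC.le_of_ge (y := LinearMap.range g) ?_ fun c hc => ⟨c, hgC c hc⟩
    rw [Submodule.disjoint_def]
    rintro _ ⟨y, rfl⟩ hyB
    by_contra hgy
    have hyD : y ∉ D := fun h => hgy (hgD y h)
    have : ¬ Disjoint (D ⊔ Submodule.span R {y}) C := fun h =>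
      hyD (hD.le_of_ge h le_sup_left
        (Submodule.mem_sup_right (Submodule.mem_span_singleton_self y)))
    rw [Submodule.disjoint_def] at this
    push Not at this
    obtain ⟨c, hc, hcC, hc0⟩ := this
    obtain ⟨d, hd, w, hw, rfl⟩ := Submodule.mem_sup.mp hc
    obtain ⟨r, rfl⟩ := Submodule.mem_span_singleton.mp hw
    have h1 := hgC _ hcC
    rw [map_add, hgD d hd, zero_add, map_smul] at h1
    exact hc0 (Submodule.disjoint_def.mp hCD _ hcC (h1 ▸ D.smul_mem r (hBD hyB)))
  rw [codisjoint_iff_le_sup]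
  intro y _
  have hker : y - g y ∈ D := by
    refine hD.le_of_ge (y := LinearMap.ker g) ?_ hgD ?_
    · exact Submodule.disjoint_def.mpr fun c hc hcC => (hgC c hcC).symm.trans hc
    · rw [LinearMap.mem_ker, map_sub, hgC _ (hrange ⟨y, rfl⟩), sub_self]
  rw [← sub_add_cancel y (g y)]
  exact add_mem (Submodule.mem_sup_right hker) (Submodule.mem_sup_left (hrange ⟨y, rfl⟩))

end Injective

section OneDimensional

variable {R : Type u} [CommRing R] [IsLocalRing R] [IsNoetherianRing R]

open IsLocalRing

/-- A Noetherian local ring of dimension at most one has an element of the maximal ideal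
that lies in no other minimal prime. -/
theorem exists_mem_maximalIdeal_forall_isPrime_isMaximal [Ring.KrullDimLE 1 R] :
    ∃ x ∈ maximalIdeal R, ∀ q : Ideal R, q.IsPrime → x ∈ q → q.IsMaximal := by
  classical
  set S := (minimalPrimes.finite_of_isNoetherianRing R).toFinset.erase (maximalIdeal R) with hS
  have hS' : ∀ q ∈ S, q ≠ maximalIdeal R ∧ q ∈ minimalPrimes R := by
    intro q hq
    simpa [hS] using hq
  have hnot : ¬ ((maximalIdeal R : Ideal R) : Set R) ⊆ ⋃ q ∈ (S : Set (Ideal R)), (q : Set R) := by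
    refine (Ideal.subset_union_prime (f := id) ⊥ ⊥ fun q hq _ _ => (hS' q hq).2.1.1).not.mpr ?_
    rintro ⟨q, hq, hle⟩
    have := (hS' q hq).2.1.1
    exact (hS' q hq).1 ((maximalIdeal.isMaximal R).eq_of_le this.ne_top hle).symm
  obtain ⟨x, hx, hxS⟩ := Set.not_subset.mp hnot
  refine ⟨x, hx, fun q hq hxq => ?_⟩
  rcases Ring.krullDimLE_one_iff.mp inferInstance q hq with h | h
  · by_contra hmax
    refine hxS (Set.mem_biUnion (x := q) ?_ hxq)
    rw [hS, Finset.mem_coe, Finset.mem_erase, Set.Finite.mem_toFinset]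
    exact ⟨fun hqm => hmax (hqm ▸ maximalIdeal.isMaximal R), h⟩
  · exact h

theorem exists_quotSMulTopLengthLE_of_mem {x : R} (hx : x ∈ maximalIdeal R)
    (hmax : ∀ q : Ideal R, q.IsPrime → x ∈ q → q.IsMaximal) :
    ∃ C : ℕ, ∀ (E : Type u) [AddCommGroup E] [Module R E], IsUniformModule R E →
      ∀ u : E, (∀ r : R, r • u = 0 ↔ r ∈ maximalIdeal R) → QuotSMulTopLengthLE R x E C := by
  have hspan : ∀ k : ℕ, ∀ q : Ideal R, q.IsPrime → Ideal.span {x ^ k} ≤ q → q.IsMaximal :=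
    fun k q hq hle => hmax q hq (hq.mem_of_pow_mem k (hle (Ideal.mem_span_singleton_self _)))
  obtain ⟨N, hN⟩ : ∃ N, maximalIdeal R ^ N ≤ Ideal.span {x} := by
    refine Ideal.exists_pow_le_of_le_radical_of_fg ?_ (IsNoetherian.noetherian _)
    rw [Ideal.radical_eq_sInf]
    refine le_sInf fun q ⟨hle, hq⟩ => (eq_maximalIdeal ?_).ge
    exact hmax q hq (hle (Ideal.mem_span_singleton_self x))
  obtain ⟨e, he⟩ := ENat.ne_top_iff_exists.mp (length_quotSMulTop_self_ne_top hmax)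
  obtain ⟨C, hC⟩ := exists_quotSMulTopLengthLE_torsionBySet_pow x (maximalIdeal R) e N
  refine ⟨C, fun E _ _ hE u hu X hX => ?_⟩
  have hp : (maximalIdeal R).IsPrime := inferInstance
  have hB := hC E (he ▸ hE.quotSMulTopLengthLE_torsionBySet hp hu
    (fun q hq h => absurd (le_maximalIdeal hq.ne_top) h.not_ge) x)
  obtain ⟨k, hk⟩ := hE.exists_pow_smul_eq_zero hp hu hx hX
  have := Module.Finite.iff_fg.mpr hX
  have hXfin : Module.length R X ≠ ⊤ := by
    refine length_ne_top_of_primes_isMaximal _ (hspan k) fun a ha m => Subtype.ext ?_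
    obtain ⟨b, rfl⟩ := Ideal.mem_span_singleton.mp ha
    change (x ^ k * b) • (m : E) = 0
    rw [mul_comm, mul_smul, hk m m.2, smul_zero]
  rw [length_quotSMulTop_eq_length_ker x hXfin]
  refine hB.length_le ((X.subtype ∘ₗ Submodule.subtype _).codRestrict _ ?_) ?_
  · intro c
    rw [Submodule.mem_torsionBySet_iff]
    rintro ⟨a, ha⟩
    obtain ⟨b, rfl⟩ := Ideal.mem_span_singleton.mp (hN ha)
    have hc : x • ((c : X) : E) = 0 := Subtype.ext_iff.mp (LinearMap.mem_ker.mp c.2)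
    change (x * b) • ((c : X) : E) = 0
    rw [mul_comm, mul_smul, hc, smul_zero]
  · intro c d hcd
    exact Subtype.ext (Subtype.ext (Subtype.ext_iff.mp hcd :))

/-- Some power of a minimal prime is annihilated by an element outside of it. -/
theorem exists_notMem_mul_pow_eq_zero {R : Type*} [CommRing R] [IsNoetherianRing R]
    {p : Ideal R} (hp : p ∈ minimalPrimes R) :
    ∃ N : ℕ, ∃ s ∉ p, ∀ a ∈ p ^ N, s * a = 0 := by
  classical
  have hpp : p.IsPrime := hp.1.1
  set S := (minimalPrimes.finite_of_isNoetherianRing R).toFinset.erase p with hS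
  have hS' : ∀ q ∈ S, q ≠ p ∧ q ∈ minimalPrimes R := by
    intro q hq
    simpa [hS] using hq
  have hex : ∀ q ∈ S, ∃ s ∈ q, s ∉ p := fun q hq =>
    Set.not_subset.mp fun h => (hS' q hq).1 (le_antisymm h (hp.2 (hS' q hq).2.1 h))
  choose! t htq htp using hex
  set s := ∏ q ∈ S, t q
  have hs : s ∉ p := fun h => by
    obtain ⟨q, hq, hqp⟩ := (hpp.prod_mem_iff).mp h
    exact htp q hq hqp
  have hsp : p * Ideal.span {s} ≤ nilradical R := by
    rw [nilradical, ← Ideal.sInf_minimalPrimes]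
    refine le_sInf fun q hq => ?_
    by_cases hqp : q = p
    · exact hqp ▸ Ideal.mul_le_left
    · refine Ideal.mul_le_right.trans ((Ideal.span_singleton_le_iff_mem _).mpr ?_)
      have hqS : q ∈ S := by
        rw [hS, Finset.mem_erase]
        exact ⟨hqp, (Set.Finite.mem_toFinset _).mpr hq⟩
      exact Ideal.mem_of_dvd _ (Finset.dvd_prod_of_mem t hqS) (htq q hqS)
  obtain ⟨N, hN⟩ := IsNoetherianRing.isNilpotent_nilradical R
  refine ⟨N, s ^ N, fun h => hs (hpp.mem_of_pow_mem N h), fun a ha => ?_⟩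
  have h1 : a * s ^ N ∈ (p * Ideal.span {s}) ^ N := by
    rw [mul_pow]
    exact Ideal.mul_mem_mul ha (Ideal.pow_mem_pow (Ideal.mem_span_singleton_self s) N)
  have h2 := Ideal.pow_right_mono hsp N h1
  rw [hN] at h2
  rw [mul_comm]
  exact h2

theorem exists_quotSMulTopLengthLE_of_mem_minimalPrimes {R : Type u} [CommRing R]
    [IsNoetherianRing R] [Ring.KrullDimLE 1 R] {x : R}
    (hmax : ∀ q : Ideal R, q.IsPrime → x ∈ q → q.IsMaximal)
    {p : Ideal R} (hp : p ∈ minimalPrimes R) :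
    ∃ C : ℕ, ∀ (E : Type u) [AddCommGroup E] [Module R E], IsUniformModule R E →
      ∀ u : E, (∀ r : R, r • u = 0 ↔ r ∈ p) → QuotSMulTopLengthLE R x E C := by
  obtain ⟨e, he⟩ := ENat.ne_top_iff_exists.mp (length_quotSMulTop_self_ne_top hmax)
  obtain ⟨N, s, hs, hsN⟩ := exists_notMem_mul_pow_eq_zero hp
  obtain ⟨C, hC⟩ := exists_quotSMulTopLengthLE_torsionBySet_pow x p e N
  refine ⟨C, fun E _ _ hE u hu => ?_⟩
  have hpp : p.IsPrime := hp.1.1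
  have hB := hC E (he ▸ hE.quotSMulTopLengthLE_torsionBySet hpp hu (fun q hq h =>
    (Ring.krullDimLE_one_iff.mp inferInstance q hq).resolve_left fun hq' =>
      h.not_ge (hq'.2 hp.1 h.le)) x)
  refine hB.of_injective (LinearMap.id.codRestrict _ fun y => ?_) fun c d hcd =>
    Subtype.ext_iff.mp hcd
  rw [Submodule.mem_torsionBySet_iff]
  rintro ⟨a, ha⟩
  refine hE.eq_zero_of_smul_eq_zero hpp hu hs ?_
  change s • a • y = 0
  rw [← mul_smul, hsN a ha, zero_smul]

theorem exists_malcevRankLE_of_isUniformModule [Ring.KrullDimLE 1 R] :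
    ∃ n : ℕ, ∀ (E : Type u) [AddCommGroup E] [Module R E],
      IsUniformModule R E → MalcevRankLE R E n := by
  classical
  obtain ⟨x, hx, hmax⟩ := exists_mem_maximalIdeal_forall_isPrime_isMaximal (R := R)
  have hex : ∀ p : Ideal R, p.IsPrime → ∃ C : ℕ, ∀ (E : Type u) [AddCommGroup E] [Module R E],
      IsUniformModule R E → ∀ u : E, (∀ r : R, r • u = 0 ↔ r ∈ p) →
        QuotSMulTopLengthLE R x E C := by
    intro p hp
    rcases Ring.krullDimLE_one_iff.mp inferInstance p hp with h | h
    · exact exists_quotSMulTopLengthLE_of_mem_minimalPrimes hmax h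
    · rw [eq_maximalIdeal h]
      exact exists_quotSMulTopLengthLE_of_mem hx hmax
  choose! C hC using hex
  set S := insert (maximalIdeal R) (minimalPrimes.finite_of_isNoetherianRing R).toFinset
  refine ⟨S.sup C, fun E _ _ hE X hX => ?_⟩
  have : Nontrivial E := let ⟨y, hy⟩ := hE.1; ⟨y, 0, hy⟩
  obtain ⟨p, hp⟩ := associatedPrimes.nonempty R E
  obtain ⟨hpp, u, hu⟩ := isAssociatedPrime_iff.mp hp
  have hpS : p ∈ S := by
    rw [Finset.mem_insert, Set.Finite.mem_toFinset]
    exact (Ring.krullDimLE_one_iff.mp inferInstance p hpp).symm.imp_left eq_maximalIdeal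
  have hlen := hC p hpp E hE u (fun r => by simp [hu, Submodule.mem_colon_singleton]) X hX
  have := Module.Finite.iff_fg.mpr hX
  obtain ⟨t, htc, ht⟩ := exists_finset_card_le_span_eq_top_of_length_quotSMulTop_le hx (C p) hlen
  refine ⟨t.image X.subtype, ?_, Finset.card_image_le.trans (htc.trans (Finset.le_sup hpS)), ?_⟩
  · rw [Finset.coe_image]
    rintro _ ⟨y, -, rfl⟩
    exact y.2
  · rw [Finset.coe_image, Submodule.span_image, ht, Submodule.map_subtype_top]

end OneDimensional

/-- Over a one Krull-dimensional local Noetherian commutative ring, there is a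
uniform finite bound on the Malcev rank of indecomposable injective modules. -/
theorem stmt0 (R : Type u) [CommRing R] [IsLocalRing R] [IsNoetherianRing R]
    (hdim : ringKrullDim R = 1) :
    ∃ n : ℕ, 0 < n ∧
      ∀ (E : Type u) [AddCommGroup E] [Module R E],
        Module.Injective R E → IsIndecomposable R E → MalcevRankLE R E n := by
  have : Ring.KrullDimLE 1 R := Ring.krullDimLE_iff.mpr (by simp [hdim])
  obtain ⟨n, hn⟩ := exists_malcevRankLE_of_isUniformModule (R := R)
  refine ⟨n + 1, n.succ_pos, fun E _ _ hinj hind X hX => ?_⟩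
  obtain ⟨s, hsX, hsn, hs⟩ := hn E (hind.isUniformModule hinj) X hX
  exact ⟨s, hsX, hsn.trans n.le_succ, hs⟩
end

section
/- Let K be a field, let n > 1 be an integer, let f = Y^n − X^n(1+X) in K[X,Y], and let D = K[X,Y]/(f). Then f is irreducible, D is an integral domain, and every ideal of D can be generated by at most n elements. -/
open DirectSum


universe u v

/-- Over a principal ideal domain `R`, every ideal of an `R`-algebra that is free of rank `n`
as a module is generated by at most `n` elements. -/
theorem Ideal.exists_finset_card_le_span_eq_of_basis {R : Type*} {S : Type*} [CommRing R]
    [IsDomain R] [IsPrincipalIdealRing R] [CommRing S] [Algebra R S] {n : ℕ}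
    (b : Module.Basis (Fin n) R S) (I : Ideal S) :
    ∃ s : Finset S, s.card ≤ n ∧ Ideal.span (s : Set S) = I := by
  classical
  obtain ⟨m, c⟩ := Submodule.basisOfPid b (I.restrictScalars R)
  have : Module.Free R S := Module.Free.of_basis b
  have : Module.Finite R S := Module.Finite.of_basis b
  have hm : m ≤ n := by
    have h := Submodule.finrank_le (I.restrictScalars R)
    rwa [Module.finrank_eq_card_basis c, Module.finrank_eq_card_basis b, Fintype.card_fin,
      Fintype.card_fin] at h
  refine ⟨Finset.univ.image fun i => (c i : S), ?_, ?_⟩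
  · exact Finset.card_image_le.trans (by simpa using hm)
  · apply le_antisymm
    · rw [Ideal.span_le]
      intro x hx
      obtain ⟨i, -, rfl⟩ := Finset.mem_image.1 (Finset.mem_coe.1 hx)
      exact (c i).2
    · intro x hx
      have h := congrArg Subtype.val (c.sum_repr ⟨x, hx⟩)
      rw [← show _ = x from h, Submodule.coe_sum]
      refine Ideal.sum_mem _ fun i _ => ?_
      rw [Submodule.coe_smul, Algebra.smul_def]
      exact Ideal.mul_mem_left _ _ (Ideal.subset_span (by simp))

open Polynomial in
/-- A monic polynomial `Y ^ n - a` is irreducible as soon as some prime divides `a` exactly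
once. -/
theorem Polynomial.irreducible_X_pow_sub_C_of_prime_dvd {R : Type*} [CommRing R] [IsDomain R]
    {p a : R} {n : ℕ} (hn : n ≠ 0) (hp : Prime p) (hpa : p ∣ a) (hpsq : ¬ p ^ 2 ∣ a) :
    Irreducible (X ^ n - C a : R[X]) := by
  have hmonic : (X ^ n - C a : R[X]).Monic := monic_X_pow_sub_C a hn
  have hdeg : (X ^ n - C a : R[X]).degree = n := degree_X_pow_sub_C (Nat.pos_of_ne_zero hn) a
  have hprime : (Ideal.span {p}).IsPrime := (Ideal.span_singleton_prime hp.ne_zero).2 hp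
  refine irreducible_of_eisenstein_criterion hprime ?_ ?_ ?_ ?_ hmonic.isPrimitive
  · rw [hmonic.leadingCoeff]
    exact fun h => hprime.ne_top ((Ideal.eq_top_iff_one _).2 h)
  · intro k hk
    rw [hdeg] at hk
    have hkn : k ≠ n := (by exact_mod_cast hk : k < n).ne
    rw [coeff_sub, coeff_X_pow, if_neg hkn, zero_sub, coeff_C]
    split_ifs
    · exact neg_mem (Ideal.mem_span_singleton.2 hpa)
    · simp
  · rw [hdeg]
    exact_mod_cast Nat.pos_of_ne_zero hn
  · rw [coeff_sub, coeff_X_pow, if_neg hn.symm, zero_sub, coeff_C_zero, neg_mem_iff,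
      Ideal.span_singleton_pow, Ideal.mem_span_singleton]
    exact hpsq

/-- with `f = Y^n - X^n(1+X)` in `K[X,Y]` (realized as `(K[X])[Y]`, where
`Y` is the outer variable and `X` the inner one), `f` is irreducible, `D = K[X,Y]/(f)` is a
domain, and every ideal of `D` is generated by at most `n` elements. -/
theorem stmt1 (K : Type u) [Field K] (n : ℕ) (hn : 1 < n)
    (f : Polynomial (Polynomial K))
    (hf : f = Polynomial.X ^ n - Polynomial.C (Polynomial.X ^ n * (1 + Polynomial.X))) :
    Irreducible f ∧
    IsDomain (Polynomial (Polynomial K) ⧸ Ideal.span {f}) ∧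
    ∀ I : Ideal (Polynomial (Polynomial K) ⧸ Ideal.span {f}),
      ∃ s : Finset (Polynomial (Polynomial K) ⧸ Ideal.span {f}),
        s.card ≤ n ∧ Ideal.span (s : Set (Polynomial (Polynomial K) ⧸ Ideal.span {f})) = I := by
  have hn0 : n ≠ 0 := by omega
  have hmonic : f.Monic := hf ▸ Polynomial.monic_X_pow_sub_C _ hn0
  have hdeg : f.natDegree = n := hf ▸ Polynomial.natDegree_X_pow_sub_C
  have hirr : Irreducible f := by
    have hp : Prime (1 + Polynomial.X : Polynomial K) := by
      simpa [add_comm] using Polynomial.prime_X_sub_C (-1 : K)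
    rw [hf]
    refine Polynomial.irreducible_X_pow_sub_C_of_prime_dvd hn0 hp (dvd_mul_left _ _) ?_
    rw [pow_two, mul_dvd_mul_iff_right hp.ne_zero]
    intro h
    obtain ⟨g, hg⟩ := hp.dvd_of_dvd_pow h
    simpa using congrArg (Polynomial.eval (-1)) hg
  refine ⟨hirr, ?_, fun I => ?_⟩
  · rw [Ideal.Quotient.isDomain_iff_prime]
    exact (Ideal.span_singleton_prime hirr.ne_zero).2 hirr.prime
  · exact Ideal.exists_finset_card_le_span_eq_of_basis (S := AdjoinRoot f)
      ((AdjoinRoot.powerBasis' hmonic).basis.reindex (finCongr hdeg)) I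
end

section
/- Let R be a chain ring with maximal ideal P, let M be an R-module, and suppose there is a surjective R-linear map from M onto a direct sum M_1 ⊕ … ⊕ M_n of nonzero R-modules. Then there exist elements y_1, …, y_n of M such that whenever a_1 y_1 + … + a_n y_n = 0 with a_i ∈ R, all a_i lie in P; consequently M contains a finitely generated submodule whose minimal number of generators is at least n. In particular, for every R-module M the dual Goldie dimension of M is at most the Malcev rank of M. -/
open DirectSum


universe u v

/-- If every relation between `y 1, …, y n` has its coefficients in the maximal ideal, then the
span of the `y i` needs at least `n` generators. -/
theorem le_card_of_span_eq_span_range {R M : Type*} [CommRing R] [IsLocalRing R]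
    [AddCommGroup M] [Module R M] {n : ℕ} (y : Fin n → M)
    (hy : ∀ a : Fin n → R, (∑ i, a i • y i) = 0 → ∀ i, a i ∈ IsLocalRing.maximalIdeal R)
    (s : Finset M)
    (hs : Submodule.span R (s : Set M) = Submodule.span R (Set.range y)) :
    n ≤ s.card := by
  have hB : ∀ i, ∃ b : s → R, ∑ j, b j • (j : M) = y i := fun i => by
    have hi : y i ∈ Submodule.span R (Set.range (Subtype.val : s → M)) := by
      have : Set.range (Subtype.val : s → M) = (s : Set M) := Subtype.range_coe
      rw [this, hs]
      exact Submodule.subset_span ⟨i, rfl⟩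
    exact (Submodule.mem_span_range_iff_exists_fun R).1 hi
  have hC : ∀ j : s, ∃ c : Fin n → R, ∑ i, c i • y i = (j : M) := fun j =>
    (Submodule.mem_span_range_iff_exists_fun R).1 (hs ▸ Submodule.subset_span j.2)
  choose B hB using hB
  choose C hC using hC
  have hBC : ∀ i k, (Matrix.of B * Matrix.of C - 1 : Matrix (Fin n) (Fin n) R) i k ∈ IsLocalRing.maximalIdeal R := by
    intro i
    refine hy ((Matrix.of B * Matrix.of C - 1 : Matrix (Fin n) (Fin n) R) i) ?_
    simp only [Matrix.sub_apply, Matrix.mul_apply, Matrix.of_apply, sub_smul,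
      Finset.sum_sub_distrib, Finset.sum_smul, mul_smul]
    rw [Finset.sum_comm]
    simp only [← Finset.smul_sum, hC, hB, Matrix.one_apply]
    simp
  have hone : (Matrix.of B).map (IsLocalRing.residue R) *
      (Matrix.of C).map (IsLocalRing.residue R) = 1 := by
    have h : (Matrix.of B * Matrix.of C - 1 : Matrix (Fin n) (Fin n) R).map (IsLocalRing.residue R) = 0 := by
      ext i k
      exact (IsLocalRing.residue_eq_zero_iff _).2 (hBC i k)
    rwa [Matrix.map_sub _ (map_sub _), Matrix.map_mul,
      Matrix.map_one _ (map_zero _) (map_one _), sub_eq_zero] at h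
  calc n = (1 : Matrix (Fin n) (Fin n) (IsLocalRing.ResidueField R)).rank := by
        rw [Matrix.rank_one, Fintype.card_fin]
    _ ≤ ((Matrix.of B).map (IsLocalRing.residue R)).rank := hone ▸ Matrix.rank_mul_le_left _ _
    _ ≤ s.card := by simpa using Matrix.rank_le_card_width ((Matrix.of B).map _)

/-- A module mapping onto a direct sum of `n` nonzero modules over a local ring contains `n`
elements all of whose relations have coefficients in the maximal ideal. -/
theorem exists_forall_relation_mem_maximalIdeal {R M : Type*} [CommRing R] [IsLocalRing R]
    [AddCommGroup M] [Module R M] {n : ℕ} {N : Fin n → Type*} [∀ i, AddCommGroup (N i)]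
    [∀ i, Module R (N i)] (hN : ∀ i, ∃ x : N i, x ≠ 0)
    (φ : M →ₗ[R] ⨁ i, N i) (hφ : Function.Surjective φ) :
    ∃ y : Fin n → M,
      ∀ a : Fin n → R, (∑ i, a i • y i) = 0 → ∀ i, a i ∈ IsLocalRing.maximalIdeal R := by
  choose x hx using hN
  choose y hy using fun i => hφ (DirectSum.lof R (Fin n) N i (x i))
  refine ⟨y, fun a ha i => ?_⟩
  have h : a i • x i = 0 := by
    have h := congrArg (fun z => DirectSum.component R (Fin n) N i (φ z)) ha
    simp only [map_sum, map_smul, hy, map_zero] at h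
    rw [Finset.sum_eq_single i] at h
    · rwa [DirectSum.component.lof_self] at h
    · intro j _ hj
      rw [DirectSum.component.of, dif_neg hj, smul_zero]
    · simp
  rw [IsLocalRing.mem_maximalIdeal, mem_nonunits_iff]
  exact fun hu => hx i (hu.smul_eq_zero.1 h)

/-- A module mapping onto a direct sum of `n` nonzero modules over a local ring has a finitely
generated submodule needing at least `n` generators. -/
theorem exists_fg_le_card_of_surjective {R M : Type*} [CommRing R] [IsLocalRing R]
    [AddCommGroup M] [Module R M] {n : ℕ} {N : Fin n → Type*} [∀ i, AddCommGroup (N i)]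
    [∀ i, Module R (N i)] (hN : ∀ i, ∃ x : N i, x ≠ 0)
    (φ : M →ₗ[R] ⨁ i, N i) (hφ : Function.Surjective φ) :
    ∃ X : Submodule R M, X.FG ∧
      ∀ s : Finset M, (s : Set M) ⊆ (X : Set M) → Submodule.span R (s : Set M) = X →
        n ≤ s.card := by
  obtain ⟨y, hy⟩ := exists_forall_relation_mem_maximalIdeal hN φ hφ
  exact ⟨Submodule.span R (Set.range y), Submodule.fg_span (Set.finite_range y),
    fun s _ hs => le_card_of_span_eq_span_range y hy s hs⟩

/-- over a chain ring `R`, if `M` maps onto a direct sum of `n` nonzero modules,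
then `M` has elements `y 1, …, y n` such that any vanishing linear combination has all its
coefficients in the maximal ideal; consequently `M` contains a finitely generated submodule
needing at least `n` generators; in particular the dual Goldie dimension of any module is at
most its Malcev rank. -/
theorem stmt3 (R : Type u) [CommRing R] [IsLocalRing R]
    (hchain : ∀ I J : Ideal R, I ≤ J ∨ J ≤ I)
    (M : Type u) [AddCommGroup M] [Module R M]
    (n : ℕ) (Mi : Fin n → Type u) [∀ i, AddCommGroup (Mi i)] [∀ i, Module R (Mi i)]
    (hnz : ∀ i, ∃ x : Mi i, x ≠ 0)
    (φ : M →ₗ[R] ⨁ i, Mi i) (hφ : Function.Surjective φ) :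
    (∃ y : Fin n → M,
      (∀ a : Fin n → R, (∑ i, a i • y i) = 0 → ∀ i, a i ∈ IsLocalRing.maximalIdeal R) ∧
      ∃ X : Submodule R M, X.FG ∧
        ∀ s : Finset M, (s : Set M) ⊆ (X : Set M) → Submodule.span R (s : Set M) = X →
          n ≤ s.card) ∧
    (∀ (M' : Type u) [AddCommGroup M'] [Module R M'] (m : ℕ),
      HasDualGoldieDim R M' m →
      ∃ X : Submodule R M', X.FG ∧
        ∀ s : Finset M', (s : Set M') ⊆ (X : Set M') → Submodule.span R (s : Set M') = X →
          m ≤ s.card) := by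
  obtain ⟨y, hy⟩ := exists_forall_relation_mem_maximalIdeal hnz φ hφ
  refine ⟨⟨y, hy, exists_fg_le_card_of_surjective hnz φ hφ⟩, ?_⟩
  rintro M' _ _ m ⟨N, hab, hmod, ψ, hψ, -, hN⟩
  exact exists_fg_le_card_of_surjective (fun i => (hN i).1) ψ hψ
end

section
/- Let R be a commutative ring satisfying one of the following two conditions: (1) R_P is an integral domain of Krull dimension one for each maximal ideal P; (2) R_P is Noetherian for each maximal ideal P. Then for every R-module M of finite Goldie dimension and every multiplicative subset S of R, the localization S^{-1}M has finite Goldie dimension. -/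
open DirectSum


universe u v

/-- If the submodules `X n` decrease and `f n ≤ X n` is disjoint from `X (n + 1)`, then the family
`f` is independent. -/
theorem iSupIndep_of_antitone_disjoint {R : Type*} {M : Type*} [Ring R] [AddCommGroup M]
    [Module R M] {f X : ℕ → Submodule R M} (hX : Antitone X) (hf : ∀ n, f n ≤ X n)
    (hd : ∀ n, Disjoint (f n) (X (n + 1))) : iSupIndep f := by
  rw [iSupIndep_iff_finsetSum_eq_zero_imp_eq_zero]
  intro s
  induction s using Finset.induction_on_min with
  | empty => simp
  | insert a s ha ih =>
    intro v hv h0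
    have has : a ∉ s := fun h => lt_irrefl _ (ha a h)
    rw [Finset.sum_insert has] at h0
    have hs : ∑ i ∈ s, v i ∈ X (a + 1) :=
      Submodule.sum_mem _ fun i hi =>
        hX (Nat.succ_le_of_lt (ha i hi)) (hf i (hv i (Finset.mem_insert_of_mem hi)))
    have hva : v a = 0 := by
      refine Submodule.disjoint_def.mp (hd a) _ (hv a (Finset.mem_insert_self _ _)) ?_
      rw [eq_neg_of_add_eq_zero_left h0]
      exact Submodule.neg_mem _ hs
    rw [hva, zero_add] at h0
    intro i hi
    rcases Finset.mem_insert.mp hi with rfl | hi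
    · exact hva
    · exact ih v (fun j hj => hv j (Finset.mem_insert_of_mem hj)) h0 i hi

theorem HasFiniteGoldieDimension.finite_of_iSupIndep {R : Type u} [Semiring R] {M : Type v}
    [AddCommMonoid M] [Module R M] (hM : HasFiniteGoldieDimension R M) {ι : Type v}
    {f : ι → Submodule R M} (h0 : ∀ i, f i ≠ ⊥) (hf : iSupIndep f) : Finite ι := by
  refine hM ι f h0 fun i => ?_
  rw [iSup_subtype (p := fun j => j ≠ i) (f := fun j => f j.1)]
  exact (hf i).eq_bot

/-- Every nonzero submodule of a module of finite Goldie dimension contains a uniform submodule. -/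
theorem HasFiniteGoldieDimension.exists_uniform_le {R : Type u} [Ring R] {M : Type v}
    [AddCommGroup M] [Module R M] (hM : HasFiniteGoldieDimension R M) {N : Submodule R M}
    (hN : N ≠ ⊥) :
    ∃ U ≤ N, U ≠ ⊥ ∧ ∀ A B : Submodule R M, A ≤ U → B ≤ U → A ≠ ⊥ → B ≠ ⊥ → ¬Disjoint A B := by
  by_contra! h
  have step : ∀ X : {X : Submodule R M // X ≤ N ∧ X ≠ ⊥},
      ∃ (A : Submodule R M) (Y : {X : Submodule R M // X ≤ N ∧ X ≠ ⊥}),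
        A ≤ X.1 ∧ Y.1 ≤ X.1 ∧ A ≠ ⊥ ∧ Disjoint A Y.1 := by
    rintro ⟨X, hXN, hX⟩
    obtain ⟨A, B, hA, hB, hA0, hB0, hAB⟩ := h X hXN hX
    exact ⟨A, ⟨B, hB.trans hXN, hB0⟩, hA, hB, hA0, hAB⟩
  choose a b ha hb ha0 hab using step
  let X : ℕ → {X : Submodule R M // X ≤ N ∧ X ≠ ⊥} := fun n => b^[n] ⟨N, le_rfl, hN⟩
  have hX : ∀ n, X (n + 1) = b (X n) := fun n => Function.iterate_succ_apply' b n _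
  have hanti : Antitone fun n => (X n).1 :=
    antitone_nat_of_succ_le fun n => by rw [hX]; exact hb _
  have hind : iSupIndep fun n => a (X n) :=
    iSupIndep_of_antitone_disjoint hanti (fun n => ha _) fun n => by
      simpa only [hX] using hab (X n)
  have hfin : Finite (ULift.{v} ℕ) :=
    hM.finite_of_iSupIndep (f := fun n => a (X n.down)) (fun n => ha0 _)
      (hind.comp ULift.down_injective)
  exact not_finite (ULift.{v} ℕ)

/-- The elements outside a suitable maximal ideal act injectively on a uniform submodule. -/
theorem exists_isMaximal_smul_injective_of_uniform {R : Type*} {M : Type*} [CommRing R]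
    [AddCommGroup M] [Module R M] {U : Submodule R M} (hU0 : U ≠ ⊥)
    (hU : ∀ A B : Submodule R M, A ≤ U → B ≤ U → A ≠ ⊥ → B ≠ ⊥ → ¬Disjoint A B) :
    ∃ P : Ideal R, P.IsMaximal ∧ ∀ x ∈ U, ∀ t ∉ P, t • x = 0 → x = 0 := by
  let I : Ideal R :=
    { carrier := {r | ∃ x ∈ U, x ≠ 0 ∧ r • x = 0}
      zero_mem' := by
        obtain ⟨x, hx, hx0⟩ := U.ne_bot_iff.mp hU0
        exact ⟨x, hx, hx0, zero_smul _ _⟩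
      add_mem' := by
        rintro r s ⟨x, hx, hx0, hrx⟩ ⟨y, hy, hy0, hsy⟩
        have hmeet := hU (Submodule.span R {x}) (Submodule.span R {y})
          ((Submodule.span_singleton_le_iff_mem _ _).mpr hx)
          ((Submodule.span_singleton_le_iff_mem _ _).mpr hy)
          (by simpa using hx0) (by simpa using hy0)
        rw [Submodule.disjoint_def] at hmeet
        push Not at hmeet
        obtain ⟨z, hzx, hzy, hz0⟩ := hmeet
        obtain ⟨c, rfl⟩ := Submodule.mem_span_singleton.mp hzx
        obtain ⟨d, hd⟩ := Submodule.mem_span_singleton.mp hzy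
        refine ⟨c • x, U.smul_mem _ hx, hz0, ?_⟩
        rw [add_smul, smul_comm r c x, hrx, smul_zero, zero_add, ← hd, smul_comm s d y, hsy,
          smul_zero]
      smul_mem' := by
        rintro c r ⟨x, hx, hx0, hrx⟩
        exact ⟨x, hx, hx0, by rw [smul_eq_mul, mul_smul, hrx, smul_zero]⟩ }
  have hI : I ≠ ⊤ := by
    rw [Ideal.ne_top_iff_one]
    rintro ⟨x, -, hx0, hx⟩
    exact hx0 (by simpa using hx)
  obtain ⟨P, hP, hIP⟩ := Ideal.exists_le_maximal I hI
  refine ⟨P, hP, fun x hx t ht htx => ?_⟩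
  by_contra hx0
  exact ht (hIP ⟨x, hx, hx0, htx⟩)

theorem sSupIndep_insert {α : Type*} [CompleteLattice α] [IsModularLattice α] {T : Set α} {U : α}
    (hT : sSupIndep T) (hU : Disjoint U (sSup T)) : sSupIndep (insert U T) := by
  intro a ha
  by_cases haU : a = U
  · subst haU
    exact hU.mono_right (sSup_le_sSup (by simp))
  · have haT : a ∈ T := ha.resolve_left haU
    rw [Set.insert_sdiff_of_notMem _ (by simpa using Ne.symm haU), sSup_insert, sup_comm]
    refine (hT haT).disjoint_sup_right_of_disjoint_sup_left (hU.symm.mono_left ?_)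
    exact sup_le (le_sSup haT) (sSup_le_sSup Set.sdiff_subset)

/-- A module of finite Goldie dimension embeds into a finite product of its localizations at
maximal ideals. -/
theorem HasFiniteGoldieDimension.exists_finset_isMaximal {R : Type u} [CommRing R] {M : Type v}
    [AddCommGroup M] [Module R M] (hM : HasFiniteGoldieDimension R M) :
    ∃ F : Finset (Ideal R), (∀ P ∈ F, P.IsMaximal) ∧
      ∀ x : M, (∀ P ∈ F, ∃ t ∉ P, t • x = 0) → x = 0 := by
  classical
  let good : Submodule R M → Prop := fun U =>
    U ≠ ⊥ ∧ ∃ P : Ideal R, P.IsMaximal ∧ ∀ x ∈ U, ∀ t ∉ P, t • x = 0 → x = 0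
  obtain ⟨T, hT⟩ := zorn_subset {T : Set (Submodule R M) | sSupIndep T ∧ ∀ U ∈ T, good U} (by
    intro c hc hchain
    refine ⟨⋃₀ c, ⟨?_, ?_⟩, fun s hs => Set.subset_sUnion_of_mem hs⟩
    · exact iSupIndep_sUnion_of_directed hchain.directedOn fun s hs => (hc hs).1
    · rintro U ⟨s, hs, hUs⟩
      exact (hc hs).2 U hUs)
  obtain ⟨hTind, hTgood⟩ := hT.prop
  have hTfin : Finite T :=
    hM.finite_of_iSupIndep (f := ((↑) : T → Submodule R M)) (fun U => (hTgood U U.2).1)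
      ((sSupIndep_iff T).mp hTind)
  have : Fintype T := Fintype.ofFinite T
  choose p hpmax hp using fun U : T => (hTgood U U.2).2
  refine ⟨Finset.univ.image p, by simpa using fun P U hU hP => hP ▸ hpmax ⟨U, hU⟩, fun x hx => ?_⟩
  replace hx : ∀ U : T, ∃ t ∉ p U, t • x = 0 := fun U =>
    hx (p U) (Finset.mem_image_of_mem p (Finset.mem_univ U))
  choose t htp htx using hx
  by_contra hx0
  obtain ⟨U, hUx, hU0, hU⟩ := hM.exists_uniform_le (N := Submodule.span R {x}) (by simpa using hx0)
  have hdisj : Disjoint U (sSup T) := by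
    refine Disjoint.mono_left hUx (Submodule.disjoint_def.mpr fun z hz hzT => ?_)
    rw [sSup_eq_iSup', Submodule.mem_iSup_iff_exists_finsupp] at hzT
    obtain ⟨g, hg, hgz⟩ := hzT
    obtain ⟨c, hc⟩ := Submodule.mem_span_singleton.mp hz
    rw [← hgz]
    refine Finset.sum_eq_zero fun V hV => ?_
    refine hp V _ (hg V) (t V) (htp V) ?_
    refine (iSupIndep_iff_finsetSum_eq_zero_imp_eq_zero _).mp ((sSupIndep_iff T).mp hTind)
      g.support (fun W => t V • g W) (fun W _ => Submodule.smul_mem _ _ (hg W)) ?_ V hV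
    rw [← Finset.smul_sum]
    change t V • (g.sum fun _ y => y) = 0
    rw [hgz, ← hc, smul_comm, htx, smul_zero]
  have hins : insert U T ⊆ T := hT.le_of_ge
    ⟨sSupIndep_insert hTind hdisj, by
      rintro V (rfl | hV)
      · exact ⟨hU0, exists_isMaximal_smul_injective_of_uniform hU0 hU⟩
      · exact hTgood V hV⟩ (Set.subset_insert U T)
  exact hU0 (disjoint_self.mp (hdisj.mono_right (le_sSup (hins (Set.mem_insert U T)))))

/-- In a Noetherian ring, the `S`-torsion of a cyclic module is killed by one element of `S`. -/
theorem exists_mul_mem_of_isNoetherianRing {A : Type*} [CommRing A] [IsNoetherianRing A]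
    (I : Ideal A) (S : Submonoid A) :
    ∃ s ∈ S, ∀ t ∈ S, ∀ r, t * (r * s) ∈ I → r * s ∈ I := by
  let J : A → Ideal A := fun s => Submodule.comap (LinearMap.lsmul A A s) I
  obtain ⟨_, ⟨s, hs, rfl⟩, hmax⟩ := (set_has_maximal_iff_noetherian (R := A) (M := A)).mpr
    inferInstance (J '' (S : Set A)) ⟨_, 1, S.one_mem, rfl⟩
  refine ⟨s, hs, fun t ht r hr => ?_⟩
  have hle : J s ≤ J (t * s) := fun r (hr : s * r ∈ I) => by
    change t * s * r ∈ I
    rw [mul_assoc]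
    exact I.mul_mem_left t hr
  have heq : J s = J (t * s) :=
    hle.eq_of_not_lt (hmax _ ⟨t * s, S.mul_mem ht hs, rfl⟩)
  have hmem : r ∈ J (t * s) := by
    change t * s * r ∈ I
    rwa [mul_assoc, mul_comm s r]
  rw [← heq] at hmem
  rw [mul_comm]
  exact hmem

/-- In a one-dimensional local domain, the `S`-torsion of a cyclic module is killed by one element
of `S`. -/
theorem exists_mul_mem_of_krullDimLE_one {A : Type*} [CommRing A] [IsDomain A] [IsLocalRing A]
    [Ring.KrullDimLE 1 A] (I : Ideal A) (S : Submonoid A) :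
    ∃ s ∈ S, ∀ t ∈ S, ∀ r, t * (r * s) ∈ I → r * s ∈ I := by
  by_cases hunit : ∀ s ∈ S, IsUnit s
  · exact ⟨1, S.one_mem, fun t ht r hr => (Ideal.unit_mul_mem_iff_mem I (hunit t ht)).mp hr⟩
  push Not at hunit
  obtain ⟨s, hs, hsu⟩ := hunit
  by_cases hI : I = ⊥
  · subst hI
    by_cases h0 : (0 : A) ∈ S
    · exact ⟨0, h0, by simp⟩
    · refine ⟨1, S.one_mem, fun t ht r hr => ?_⟩
      exact (mul_eq_zero.mp hr).resolve_left (ne_of_mem_of_not_mem ht h0)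
  · have hrad : s ∈ I.radical := by
      rw [Ideal.radical_eq_sInf, Ideal.mem_sInf]
      rintro Q ⟨hIQ, hQ⟩
      have hQmax : Q.IsMaximal := hQ.isMaximal_of_ne_bot fun h => hI (le_bot_iff.mp (h ▸ hIQ))
      rw [IsLocalRing.eq_maximalIdeal hQmax]
      exact (IsLocalRing.mem_maximalIdeal s).mpr hsu
    obtain ⟨n, hn⟩ := hrad
    exact ⟨s ^ n, S.pow_mem hs n, fun t ht r hr => I.mul_mem_left r hn⟩

/-- If the `S`-torsion of cyclic modules over `R_P` is killed by one element of `S`, then the same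
holds for cyclic submodules of an `R`-module, up to elements outside `P`. -/
theorem exists_smul_eq_zero_of_atPrime {R : Type*} {M : Type*} [CommRing R] [AddCommGroup M]
    [Module R M] (S : Submonoid R) (P : Ideal R) [P.IsPrime]
    (h : ∀ (I : Ideal (Localization.AtPrime P)) (S' : Submonoid (Localization.AtPrime P)),
      ∃ s ∈ S', ∀ t ∈ S', ∀ r, t * (r * s) ∈ I → r * s ∈ I) (x : M) :
    ∃ s ∈ S, ∀ t ∈ S, ∀ r : R, (∃ w ∉ P, w • t • (r * s) • x = 0) →
      ∃ w ∉ P, w • (r * s) • x = 0 := by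
  let φ := LocalizedModule.mkLinearMap P.primeCompl M
  have hφ : ∀ y : M, φ y = 0 ↔ ∃ w ∉ P, w • y = 0 := fun y =>
    LocalizedModule.mem_ker_mkLinearMap_iff
  obtain ⟨_, ⟨s, hs, rfl⟩, hmax⟩ := h (Ideal.torsionOf (Localization.AtPrime P) _ (φ x))
    (S.map (algebraMap R (Localization.AtPrime P)))
  refine ⟨s, hs, fun t ht r hr => ?_⟩
  rw [← hφ] at hr ⊢
  have := hmax _ ⟨t, ht, rfl⟩ (algebraMap R _ r)
  simp only [← map_mul, Ideal.mem_torsionOf_iff, algebraMap_smul, ← map_smul] at this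
  exact this (by rwa [mul_smul])

/-- The local condition at finitely many primes can be achieved simultaneously. -/
theorem exists_smul_eq_zero_of_finset {R : Type*} {M : Type*} [CommRing R] [AddCommGroup M]
    [Module R M] (S : Submonoid R) (F : Finset (Ideal R)) (x : M)
    (h : ∀ P ∈ F, ∃ s ∈ S, ∀ t ∈ S, ∀ r : R, (∃ w ∉ P, w • t • (r * s) • x = 0) →
      ∃ w ∉ P, w • (r * s) • x = 0) :
    ∃ s ∈ S, ∀ P ∈ F, ∀ t ∈ S, ∀ r : R, (∃ w ∉ P, w • t • (r * s) • x = 0) →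
      ∃ w ∉ P, w • (r * s) • x = 0 := by
  classical
  induction F using Finset.induction_on with
  | empty => exact ⟨1, S.one_mem, by simp⟩
  | insert Q F hQ ih =>
    obtain ⟨s, hs, hsF⟩ := ih fun P hP => h P (Finset.mem_insert_of_mem hP)
    obtain ⟨s', hs', hsQ⟩ := h Q (Finset.mem_insert_self Q F)
    refine ⟨s * s', S.mul_mem hs hs', fun P hP t ht r => ?_⟩
    rcases Finset.mem_insert.mp hP with rfl | hP
    · rw [← mul_assoc]
      exact hsQ t ht (r * s)
    · rw [mul_comm s, ← mul_assoc]
      exact hsF P hP t ht (r * s')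

/-- If every cyclic submodule has a multiple by an element of `S` without `S`-torsion, then
localization at `S` preserves finite Goldie dimension. -/
theorem HasFiniteGoldieDimension.localizedModule {R : Type u} {M : Type u} [CommRing R]
    [AddCommGroup M] [Module R M] (hM : HasFiniteGoldieDimension R M) (S : Submonoid R)
    (h : ∀ x : M, ∃ s ∈ S, ∀ t ∈ S, ∀ r : R, t • (r * s) • x = 0 → (r * s) • x = 0) :
    HasFiniteGoldieDimension (Localization S) (LocalizedModule S M) := by
  intro ι f hf0 hf
  let φ := LocalizedModule.mkLinearMap S M
  have hφ : ∀ y : M, φ y = 0 ↔ ∃ t ∈ S, t • y = 0 := fun y =>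
    LocalizedModule.mem_ker_mkLinearMap_iff
  have hex : ∀ i, ∃ y : M, φ y ∈ f i ∧ y ≠ 0 ∧ ∀ r : R, φ (r • y) = 0 → r • y = 0 := by
    intro i
    obtain ⟨z, hz, hz0⟩ := (f i).ne_bot_iff.mp (hf0 i)
    induction z using LocalizedModule.induction_on with
    | _ x u =>
      have hx : φ x = algebraMap R (Localization S) u • LocalizedModule.mk x u := by
        rw [algebraMap_smul, LocalizedModule.smul'_mk]
        exact (LocalizedModule.mk_cancel u x).symm
      obtain ⟨s, hs, hsx⟩ := h x
      refine ⟨s • x, ?_, ?_, ?_⟩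
      · rw [map_smul, hx, ← algebraMap_smul (Localization S) s]
        exact (f i).smul_mem _ ((f i).smul_mem _ hz)
      · intro h0
        apply hz0
        rw [← LocalizedModule.zero_mk u, LocalizedModule.mk_eq]
        refine ⟨⟨s, hs⟩, ?_⟩
        rw [smul_zero, smul_zero, smul_comm]
        change u • s • x = 0
        rw [h0, smul_zero]
      · intro r hr
        obtain ⟨t, ht, htr⟩ := (hφ _).mp hr
        rw [← mul_smul r s x] at htr ⊢
        exact hsx t ht r htr
  choose y hyf hy0 hy using hex
  refine hM ι (fun i => Submodule.span R {y i}) (fun i => by simpa using hy0 i) fun i => ?_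
  rw [← disjoint_iff, Submodule.disjoint_def]
  intro z hz hz'
  obtain ⟨r, rfl⟩ := Submodule.mem_span_singleton.mp hz
  apply hy i r
  have hle : (⨆ j : {j : ι // j ≠ i}, Submodule.span R {y j.1}) ≤
      ((⨆ j : {j : ι // j ≠ i}, f j.1).restrictScalars R).comap φ := by
    refine iSup_le fun j => (Submodule.span_singleton_le_iff_mem _ _).mpr ?_
    exact Submodule.mem_iSup_of_mem (p := fun j : {j : ι // j ≠ i} => f j.1) j (hyf j)
  refine Submodule.disjoint_def.mp (disjoint_iff.mpr (hf i)) _ ?_ (hle hz')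
  rw [map_smul, ← algebraMap_smul (Localization S) r]
  exact (f i).smul_mem _ (hyf i)

/-- if every localization of `R` at a maximal ideal is a one-dimensional domain,
or every localization of `R` at a maximal ideal is Noetherian, then localization preserves
finiteness of Goldie dimension. -/
theorem stmt4 (R : Type u) [CommRing R]
    (hyp :
      (∀ (P : Ideal R) (hP : P.IsMaximal),
        letI : P.IsPrime := hP.isPrime
        IsDomain (Localization.AtPrime P) ∧ ringKrullDim (Localization.AtPrime P) = 1) ∨
      (∀ (P : Ideal R) (hP : P.IsMaximal),
        letI : P.IsPrime := hP.isPrime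
        IsNoetherianRing (Localization.AtPrime P)))
    (M : Type u) [AddCommGroup M] [Module R M]
    (hM : HasFiniteGoldieDimension R M) (S : Submonoid R) :
    HasFiniteGoldieDimension (Localization S) (LocalizedModule S M) := by
  obtain ⟨F, hF, hinj⟩ := hM.exists_finset_isMaximal
  refine hM.localizedModule S fun x => ?_
  obtain ⟨s, hs, hsF⟩ := exists_smul_eq_zero_of_finset S F x fun P hP => by
    have hPmax := hF P hP
    have : P.IsPrime := hPmax.isPrime
    refine exists_smul_eq_zero_of_atPrime S P (fun I S' => ?_) x
    rcases hyp with hyp | hyp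
    · obtain ⟨hdom, hdim⟩ := hyp P hPmax
      have : Ring.KrullDimLE 1 (Localization.AtPrime P) :=
        Ring.krullDimLE_iff.mpr (by rw [hdim]; rfl)
      exact exists_mul_mem_of_krullDimLE_one I S'
    · have := hyp P hPmax
      exact exists_mul_mem_of_isNoetherianRing I S'
  refine ⟨s, hs, fun t ht r htr => hinj _ fun P hP => hsF P hP t ht r ⟨1, ?_, ?_⟩⟩
  · exact (Ideal.ne_top_iff_one P).mp (hF P hP).ne_top
  · rw [htr, smul_zero]
end

section
/- Let R be a commutative ring of Krull dimension zero (every prime ideal is maximal). Then for every R-module M and every multiplicative subset S of R, the canonical map M → S^{-1}M is surjective; consequently, if M has finite dual Goldie dimension then S^{-1}M has finite dual Goldie dimension, and dG S^{-1}M ≤ dG M. -/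
open DirectSum


universe u v

/-- Every element of a zero-dimensional commutative ring is strongly π-regular. -/
theorem exists_pow_mul_mul_eq_pow {R : Type*} [CommRing R]
    (hdim : ∀ I : Ideal R, I.IsPrime → I.IsMaximal) (s : R) :
    ∃ (r : R) (n : ℕ), s ^ n * (r * s) = s ^ n := by
  by_contra! h
  let T : Submonoid R :=
    { carrier := {x | ∃ (r : R) (n : ℕ), x = s ^ n * (1 - r * s)}
      one_mem' := ⟨0, 0, by simp⟩
      mul_mem' := by
        rintro _ _ ⟨r, n, rfl⟩ ⟨r', n', rfl⟩
        exact ⟨r + r' - r * r' * s, n + n', by ring⟩ }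
  have hT : Disjoint ((⊥ : Ideal R) : Set R) (T : Set R) := by
    rw [Set.disjoint_left]
    rintro x hx ⟨r, n, hrn⟩
    have hx0 : x = 0 := by simpa using hx
    exact h r n (by linear_combination hrn - hx0)
  obtain ⟨P, hP, -, hPT⟩ := Ideal.exists_le_prime_disjoint ⊥ T hT
  have hsP : s ∉ P := fun hs =>
    Set.disjoint_left.1 hPT hs ⟨0, 1, by simp⟩
  obtain ⟨r, i, hi, hri⟩ := (hdim P hP).exists_inv hsP
  exact Set.disjoint_left.1 hPT hi ⟨r, 0, by linear_combination hri⟩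

/-- Over a zero-dimensional ring, the inverse of `s ∈ S` acts on localizations as an element
of the ring. -/
theorem exists_mk_eq_mk_smul {R : Type*} [CommRing R]
    (hdim : ∀ I : Ideal R, I.IsPrime → I.IsMaximal) (S : Submonoid R) (s : S) :
    ∃ r : R, ∀ (M : Type*) [AddCommGroup M] [Module R M] (m : M),
      LocalizedModule.mk m s = LocalizedModule.mkLinearMap S M (r • m) := by
  obtain ⟨r, n, h⟩ := exists_pow_mul_mul_eq_pow hdim (s : R)
  refine ⟨r, fun M _ _ m => ?_⟩
  rw [LocalizedModule.mkLinearMap_apply, LocalizedModule.mk_eq]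
  refine ⟨s ^ n, ?_⟩
  simp only [Submonoid.smul_def, SubmonoidClass.coe_pow, OneMemClass.coe_one, smul_smul]
  congr 1
  linear_combination -h

theorem mkLinearMap_surjective_of_isMaximal {R : Type*} [CommRing R]
    (hdim : ∀ I : Ideal R, I.IsPrime → I.IsMaximal) (S : Submonoid R)
    (M : Type*) [AddCommGroup M] [Module R M] :
    Function.Surjective (LocalizedModule.mkLinearMap S M) := by
  intro x
  induction x using LocalizedModule.induction_on with
  | h m s =>
    obtain ⟨r, hr⟩ := exists_mk_eq_mk_smul hdim S s
    exact ⟨r • m, (hr M m).symm⟩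

section Comap

variable {R : Type*} [CommRing R] {S : Submonoid R} {M : Type*} [AddCommGroup M] [Module R M]

/-- The preimage in `M` of a submodule of `S⁻¹M`. -/
noncomputable def comapMk (G : Submodule (Localization S) (LocalizedModule S M)) : Submodule R M :=
  (G.restrictScalars R).comap (LocalizedModule.mkLinearMap S M)

theorem mem_comapMk {G : Submodule (Localization S) (LocalizedModule S M)} {m : M} :
    m ∈ comapMk G ↔ LocalizedModule.mkLinearMap S M m ∈ G := Iff.rfl

theorem comapMk_eq_top (hM : Function.Surjective (LocalizedModule.mkLinearMap S M))
    {G : Submodule (Localization S) (LocalizedModule S M)} : comapMk G = ⊤ ↔ G = ⊤ := by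
  simp only [Submodule.eq_top_iff', mem_comapMk]
  exact hM.forall.symm

theorem sup_comapMk_eq_top {A : Submodule R M}
    {K G : Submodule (Localization S) (LocalizedModule S M)}
    (hA : ∀ x ∈ K, ∃ a ∈ A, LocalizedModule.mkLinearMap S M a = x) (h : K ⊔ G = ⊤) :
    A ⊔ comapMk G = ⊤ := by
  rw [Submodule.eq_top_iff']
  intro m
  have hm : LocalizedModule.mkLinearMap S M m ∈ K ⊔ G := h ▸ Submodule.mem_top
  obtain ⟨x, hx, g, hg, hxg⟩ := Submodule.mem_sup.1 hm
  obtain ⟨a, ha, rfl⟩ := hA x hx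
  refine Submodule.mem_sup.2 ⟨a, ha, m - a, ?_, by abel⟩
  rw [mem_comapMk, map_sub, ← hxg, add_sub_cancel_left]
  exact hg

theorem IsSuperfluous.of_image_mk (hM : Function.Surjective (LocalizedModule.mkLinearMap S M))
    {A : Submodule R M} (hAs : IsSuperfluous A)
    {K : Submodule (Localization S) (LocalizedModule S M)}
    (hA : ∀ x ∈ K, ∃ a ∈ A, LocalizedModule.mkLinearMap S M a = x) : IsSuperfluous K :=
  fun _ hG => (comapMk_eq_top hM).1 (hAs _ (sup_comapMk_eq_top hA hG))

theorem IsCouniform.localizedModule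
    (hM : Function.Surjective (LocalizedModule.mkLinearMap S M)) (h : IsCouniform R M)
    (hne : ∃ x : LocalizedModule S M, x ≠ 0) :
    IsCouniform (Localization S) (LocalizedModule S M) := by
  refine ⟨hne, fun K hK => (h.2 (comapMk K) (mt (comapMk_eq_top hM).1 hK)).of_image_mk hM ?_⟩
  intro x hx
  obtain ⟨a, rfl⟩ := hM x
  exact ⟨a, hx, rfl⟩

end Comap

theorem HasDualGoldieDim.localizedModule {R : Type u} [CommRing R]
    (hdim : ∀ I : Ideal R, I.IsPrime → I.IsMaximal)
    {M : Type u} [AddCommGroup M] [Module R M] (S : Submonoid R) {n : ℕ}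
    (h : HasDualGoldieDim R M n) :
    ∃ m : ℕ, m ≤ n ∧ HasDualGoldieDim (Localization S) (LocalizedModule S M) m := by
  classical
  obtain ⟨N, hab, hmod, φ, hφ, hker, hN⟩ := h
  have hsurj := mkLinearMap_surjective_of_isMaximal hdim S
  let J := {i : Fin n // ∃ x : LocalizedModule S (N i), x ≠ 0}
  let e : Fin (Fintype.card J) ≃ J := (Fintype.equivFin J).symm
  let ψ : LocalizedModule S M →ₗ[Localization S]
      ∀ j : Fin (Fintype.card J), LocalizedModule S (N (e j).1) :=
    LinearMap.pi fun j =>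
      LocalizedModule.map S (DirectSum.component R (Fin n) N (e j).1 ∘ₗ φ)
  have hψ (m : M) (j) : ψ (LocalizedModule.mkLinearMap S M m) j =
      LocalizedModule.mkLinearMap S (N (e j).1) (φ m (e j).1) := by
    simp [ψ, LocalizedModule.mkLinearMap_apply, LocalizedModule.map_mk, DirectSum.component]
    rfl
  let E := DirectSum.linearEquivFunOnFintype (Localization S) (Fin (Fintype.card J))
    fun j => LocalizedModule S (N (e j).1)
  refine ⟨Fintype.card J, (Fintype.card_subtype_le _).trans_eq (Fintype.card_fin n),
    fun j => LocalizedModule S (N (e j).1), inferInstance, inferInstance,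
    E.symm.toLinearMap ∘ₗ ψ, ?_, ?_, fun j => ?_⟩
  · refine E.symm.surjective.comp fun y => ?_
    choose z hz using fun j => hsurj (N (e j).1) (y j)
    obtain ⟨m, hm⟩ := hφ (∑ j, DirectSum.of N (e j).1 (z j))
    refine ⟨LocalizedModule.mkLinearMap S M m, funext fun j => ?_⟩
    rw [hψ, hm, ← hz]
    congr 1
    rw [DFinsupp.finsetSum_apply, Finset.sum_eq_single j]
    · exact DirectSum.of_eq_same _ _
    · intro k _ hk
      exact DirectSum.of_eq_of_ne _ _ _ fun h => hk (e.injective (Subtype.ext h.symm))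
    · simp
  · refine hker.of_image_mk (hsurj M) fun x hx => ?_
    obtain ⟨m, rfl⟩ := hsurj M x
    have hx0 : ψ (LocalizedModule.mkLinearMap S M m) = 0 := by
      simpa using hx
    have hcomp (i : Fin n) : ∃ s : S, s • φ m i = 0 := by
      have hi : LocalizedModule.mkLinearMap S (N i) (φ m i) = 0 := by
        by_contra hne
        obtain ⟨j, hj⟩ := e.surjective ⟨i, _, hne⟩
        obtain rfl : (e j).1 = i := congrArg Subtype.val hj
        exact hne ((hψ m j).symm.trans (congrFun hx0 j))
      exact (IsLocalizedModule.eq_zero_iff S (LocalizedModule.mkLinearMap S (N i))).1 hi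
    choose s hs using hcomp
    have hsm : φ ((∏ i, s i) • m) = 0 := by
      ext i
      rw [Submonoid.smul_def, map_smul, DirectSum.smul_apply, DirectSum.zero_apply,
        ← Submonoid.smul_def, ← Finset.prod_erase_mul _ _ (Finset.mem_univ i), mul_smul, hs,
        smul_zero]
    obtain ⟨r, hr⟩ := exists_mk_eq_mk_smul hdim S (∏ i, s i)
    refine ⟨r • (∏ i, s i) • m, ?_, ?_⟩
    · rw [LinearMap.mem_ker, map_smul, hsm, smul_zero]
    · rw [← hr M, LocalizedModule.mkLinearMap_apply, LocalizedModule.mk_cancel]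
  · exact (hN _).localizedModule (hsurj _) (e j).2

/-- over a zero-dimensional commutative ring, the canonical map `M → S⁻¹M` is
surjective, and consequently finite dual Goldie dimension is preserved (and does not increase)
under localization. -/
theorem stmt5 (R : Type u) [CommRing R]
    (hdim : ∀ I : Ideal R, I.IsPrime → I.IsMaximal)
    (M : Type u) [AddCommGroup M] [Module R M] (S : Submonoid R) :
    Function.Surjective (LocalizedModule.mkLinearMap S M) ∧
    ∀ n : ℕ, HasDualGoldieDim R M n →
      ∃ m : ℕ, m ≤ n ∧ HasDualGoldieDim (Localization S) (LocalizedModule S M) m :=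
  ⟨mkLinearMap_surjective_of_isMaximal hdim S M, fun _ h => h.localizedModule hdim S⟩
end

section
/- Let R be a local unique factorization domain of Krull dimension two. Then R has infinitely many pairwise non-associated prime elements. Moreover, if p is a prime element of R and S = {p^n : n ∈ ℕ}, then S^{-1}R has infinite dual Goldie dimension: for every positive integer n there is a nonzero element a of S^{-1}R such that S^{-1}R/aS^{-1}R is isomorphic to a product of n nonzero rings. -/
open DirectSum


universe u v

/-- In a local domain of Krull dimension at most two, a prime ideal containing two non-associated
prime elements is the maximal ideal. -/
theorem eq_maximalIdeal_of_mem_of_not_associated {R : Type u} [CommRing R] [IsDomain R]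
    [IsLocalRing R] (hdim : ringKrullDim R ≤ 2) {q r : R} (hq : Prime q) (hr : Prime r)
    (hqr : ¬Associated q r) {Q : Ideal R} [hQ : Q.IsPrime] (hqQ : q ∈ Q) (hrQ : r ∈ Q) :
    Q = IsLocalRing.maximalIdeal R := by
  by_contra hne
  have hqp : (Ideal.span {q}).IsPrime := (Ideal.span_singleton_prime hq.ne_zero).2 hq
  have h₀ : (⊥ : Ideal R) < Ideal.span {q} :=
    bot_lt_iff_ne_bot.2 (by simpa using hq.ne_zero)
  have h₁ : Ideal.span {q} < Q := by
    refine lt_of_le_of_ne ((Ideal.span_singleton_le_iff_mem _).2 hqQ) fun h => hqr ?_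
    rw [← h, Ideal.mem_span_singleton] at hrQ
    exact hq.associated_of_dvd hr hrQ
  have h₂ : Q < IsLocalRing.maximalIdeal R :=
    lt_of_le_of_ne (IsLocalRing.le_maximalIdeal hQ.ne_top) hne
  let c : LTSeries (PrimeSpectrum R) :=
    { length := 3
      toFun := ![⟨⊥, Ideal.isPrime_bot⟩, ⟨_, hqp⟩, ⟨Q, hQ⟩,
        ⟨IsLocalRing.maximalIdeal R, inferInstance⟩]
      step := by
        intro i
        fin_cases i
        · exact h₀
        · exact h₁
        · exact h₂ }
  have h₃ : ((3 : ℕ) : WithBot ℕ∞) ≤ 2 := (Order.LTSeries.length_le_krullDim c).trans hdim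
  exact absurd h₃ (by decide)

/-- A local unique factorization domain of Krull dimension greater than one has infinitely many
prime elements up to associates. -/
theorem infinite_setOf_prime_associates {R : Type u} [CommRing R] [IsDomain R]
    [IsLocalRing R] [UniqueFactorizationMonoid R] (hdim : ¬Ring.KrullDimLE 1 R) :
    {x : Associates R | Prime x}.Infinite := by
  intro hfin
  refine hdim (Ring.krullDimLE_one_iff_of_isPrime_bot.2 fun P hP hPprime => ?_)
  obtain ⟨g, hg⟩ := (Associates.mk_surjective (M := R)).hasRightInverse
  have hspan : ∀ x : Associates R, Prime x → (Ideal.span {g x}).IsPrime := fun x hx => by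
    have hx' : Prime (g x) := by
      rwa [← Associates.prime_mk, hg]
    exact (Ideal.span_singleton_prime hx'.ne_zero).2 hx'
  have hassoc : ∀ q : R, q ∈ Ideal.span {g (Associates.mk q)} := fun q =>
    Ideal.mem_span_singleton.2 (Associates.mk_dvd_mk.1 (by rw [hg]))
  have hcover : (IsLocalRing.maximalIdeal R : Set R) ⊆
      ⋃ x ∈ (↑hfin.toFinset : Set (Associates R)), (Ideal.span {g x} : Set R) := by
    intro y hy
    have hy' : ∃ q, Prime q ∧ q ∣ y := by
      by_cases h : y = 0
      · obtain ⟨q, -, hq⟩ := hPprime.exists_mem_prime_of_ne_bot hP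
        exact ⟨q, hq, h ▸ dvd_zero q⟩
      · obtain ⟨q, hq, hqy⟩ := WfDvdMonoid.exists_irreducible_factor
          ((IsLocalRing.mem_maximalIdeal y).1 hy) h
        exact ⟨q, hq.prime, hqy⟩
    obtain ⟨q, hq, hqy⟩ := hy'
    refine Set.mem_biUnion (x := Associates.mk q) (by simpa using Associates.prime_mk.2 hq) ?_
    exact Ideal.mem_of_dvd _ hqy (hassoc q)
  obtain ⟨x, hx, hle⟩ := (Ideal.subset_union_prime 0 0
    (fun i hi _ _ => hspan i (by simpa using hi))).1 hcover
  obtain ⟨q, hqP, hq⟩ := hPprime.exists_mem_prime_of_ne_bot hP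
  have hx' : Prime (g x) := by
    rw [← Associates.prime_mk, hg]
    simpa using hx
  have hqx : q ∈ Ideal.span {g x} := hle (IsLocalRing.le_maximalIdeal hPprime.ne_top hqP)
  have hxq : g x ∈ P :=
    Ideal.mem_of_dvd _ ((hx'.associated_of_dvd hq (Ideal.mem_span_singleton.1 hqx)).symm.dvd) hqP
  have hPm : P = IsLocalRing.maximalIdeal R :=
    le_antisymm (IsLocalRing.le_maximalIdeal hPprime.ne_top)
      (hle.trans ((Ideal.span_singleton_le_iff_mem _).2 hxq))
  exact hPm ▸ inferInstance

/-- An infinite set of prime classes up to associates has a sequence of pairwise non-associated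
representatives. -/
theorem exists_nat_seq_prime_not_associated {R : Type u} [CommRing R] [IsDomain R]
    {s : Set (Associates R)} (hs : s.Infinite) :
    ∃ f : ℕ → R, (∀ i, Associates.mk (f i) ∈ s) ∧ ∀ i j, i ≠ j → ¬Associated (f i) (f j) := by
  obtain ⟨g, hg⟩ := (Associates.mk_surjective (M := R)).hasRightInverse
  refine ⟨fun i => g (hs.natEmbedding s i : Associates R), fun i => ?_, fun i j hij h => ?_⟩
  · rw [hg]
    exact (hs.natEmbedding s i).2
  · rw [← Associates.mk_eq_mk_iff_associated, hg, hg] at h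
    exact hij ((hs.natEmbedding s).injective (Subtype.ext h))

/-- Inverting a prime element of a local domain of Krull dimension at most two makes
non-associated prime elements coprime. -/
theorem isCoprime_algebraMap_away {R : Type u} [CommRing R] [IsDomain R] [IsLocalRing R]
    (hdim : ringKrullDim R ≤ 2) {p q r : R} (hp : Prime p) (hq : Prime q) (hr : Prime r)
    (hqr : ¬Associated q r) :
    IsCoprime (algebraMap R (Localization (Submonoid.powers p)) q)
      (algebraMap R (Localization (Submonoid.powers p)) r) := by
  rw [← Ideal.isCoprime_span_singleton_iff, Ideal.isCoprime_iff_sup_eq]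
  by_contra hne
  obtain ⟨N, hN, hle⟩ := Ideal.exists_le_maximal _ hne
  have hmax := eq_maximalIdeal_of_mem_of_not_associated hdim hq hr hqr
    (Q := N.comap (algebraMap R _))
    (hle (Ideal.mem_sup_left (Ideal.mem_span_singleton_self _)))
    (hle (Ideal.mem_sup_right (Ideal.mem_span_singleton_self _)))
  have hpN : p ∈ N.comap (algebraMap R (Localization (Submonoid.powers p))) := by
    rw [hmax, IsLocalRing.mem_maximalIdeal]
    exact hp.not_isUnit
  exact hN.ne_top (Ideal.eq_top_of_isUnit_mem _ hpN (IsLocalization.map_units _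
    (⟨p, Submonoid.mem_powers p⟩ : Submonoid.powers p)))

/-- a local UFD of Krull dimension two has infinitely many pairwise non-associated
prime elements, and for any prime element `p`, localizing at the powers of `p` yields a ring of
infinite dual Goldie dimension: for each `n > 0` some proper quotient by a nonzero principal
ideal is a product of `n` nonzero rings. -/
theorem stmt6 (R : Type u) [CommRing R] [IsDomain R] [IsLocalRing R]
    [UniqueFactorizationMonoid R] (hdim : ringKrullDim R = 2) :
    (∃ f : ℕ → R, (∀ i, Prime (f i)) ∧ ∀ i j, i ≠ j → ¬Associated (f i) (f j)) ∧
    ∀ p : R, Prime p → ∀ n : ℕ, 0 < n →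
      ∃ a : Localization (Submonoid.powers p), a ≠ 0 ∧
        ∃ (T : Fin n → Type u) (hT : ∀ i, CommRing (T i)),
          letI := hT
          (∀ i, Nontrivial (T i)) ∧
          Nonempty ((Localization (Submonoid.powers p) ⧸
              Ideal.span ({a} : Set (Localization (Submonoid.powers p)))) ≃+* ∀ i, T i) := by
  have hinf : {x : Associates R | Prime x}.Infinite := infinite_setOf_prime_associates fun h => by
    rw [Ring.krullDimLE_iff, hdim] at h
    exact absurd h (by decide)
  refine ⟨?_, fun p hp n _ => ?_⟩
  · obtain ⟨f, hf, hfa⟩ := exists_nat_seq_prime_not_associated hinf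
    exact ⟨f, fun i => Associates.prime_mk.1 (hf i), hfa⟩
  obtain ⟨f, hf, hfa⟩ :=
    exists_nat_seq_prime_not_associated (hinf.sdiff (Set.finite_singleton (Associates.mk p)))
  have hprime : ∀ i, Prime (f i) := fun i => Associates.prime_mk.1 (hf i).1
  let L := Localization (Submonoid.powers p)
  have hinj : Function.Injective (algebraMap R L) :=
    IsLocalization.injective L (powers_le_nonZeroDivisors_of_noZeroDivisors hp.ne_zero)
  have hcop : ∀ i j : Fin n, i ≠ j → IsCoprime (algebraMap R L (f i)) (algebraMap R L (f j)) :=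
    fun i j hij => isCoprime_algebraMap_away hdim.le hp (hprime i) (hprime j)
      (hfa i j (Fin.val_injective.ne hij))
  refine ⟨∏ i : Fin n, algebraMap R L (f i), ?_,
    fun i => L ⧸ Ideal.span {algebraMap R L (f i)}, fun i => inferInstance, fun i => ?_, ⟨?_⟩⟩
  · rw [← map_prod, Ne, map_eq_zero_iff _ hinj, Finset.prod_eq_zero_iff]
    rintro ⟨i, -, hi⟩
    exact (hprime i).ne_zero hi
  · rw [Ideal.Quotient.nontrivial_iff, Ne, Ideal.span_singleton_eq_top,
      IsLocalization.algebraMap_isUnit_iff (Submonoid.powers p)]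
    rintro ⟨_, ⟨k, rfl⟩, hk⟩
    refine (hf i).2 (Associates.mk_eq_mk_iff_associated.2 ?_)
    exact (hprime i).associated_of_dvd hp ((hprime i).dvd_of_dvd_pow hk)
  · exact (Ideal.quotEquivOfEq (Ideal.iInf_span_singleton hcop).symm).trans
      (Ideal.quotientInfRingEquivPiQuotient _ fun i j hij =>
        (Ideal.isCoprime_span_singleton_iff _ _).2 (hcop i j hij))
end

section
/- Let R be a chain ring and let n be a positive integer such that every finitely generated uniform R-module is generated by at most n elements. Then every finitely generated R-module M of Goldie dimension p is generated by at most n·p elements. -/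
open DirectSum


universe u v

/-- A uniform submodule of `M`: nonzero, and any two of its nonzero submodules intersect
nontrivially. -/
def IsUniformSubmodule {R : Type u} [Semiring R] {M : Type v} [AddCommMonoid M] [Module R M]
    (U : Submodule R M) : Prop :=
  U ≠ ⊥ ∧ ∀ A B : Submodule R M, A ≤ U → B ≤ U → A ≠ ⊥ → B ≠ ⊥ → A ⊓ B ≠ ⊥

/-- If the image of `N` in `M ⧸ K` is spanned by at most `a` elements and every finitely generated
submodule of `N ⊓ K` is spanned by at most `b` elements, then `N` is spanned by at most `a + b`
elements. -/
theorem Submodule.FG.exists_finset_card_le_add {R : Type u} [Ring R] {M : Type v} [AddCommGroup M]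
    [Module R M] {N : Submodule R M} (hN : N.FG) (K : Submodule R M) {a b : ℕ}
    (ha : ∃ s : Finset (M ⧸ K), s.card ≤ a ∧ Submodule.span R (s : Set (M ⧸ K)) = N.map K.mkQ)
    (hb : ∀ L : Submodule R M, L.FG → L ≤ N ⊓ K →
      ∃ s : Finset M, s.card ≤ b ∧ Submodule.span R (s : Set M) = L) :
    ∃ s : Finset M, s.card ≤ a + b ∧ Submodule.span R (s : Set M) = N := by
  classical
  obtain ⟨t, htcard, ht⟩ := ha
  have hlift : ∀ y ∈ t, ∃ x ∈ N, K.mkQ x = y := fun y hy => by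
    have hy' : y ∈ N.map K.mkQ := ht ▸ Submodule.subset_span hy
    exact hy'
  choose! g hgN hg using hlift
  set S := Submodule.span R ((t.image g : Finset M) : Set M) with hS
  have hSN : S ≤ N := by
    rw [hS, Submodule.span_le]
    intro x hx
    obtain ⟨y, hy, rfl⟩ := Finset.mem_image.1 (Finset.mem_coe.1 hx)
    exact hgN y hy
  have hSmap : S.map K.mkQ = N.map K.mkQ := by
    rw [hS, Submodule.map_span, ← ht]
    congr 1
    ext y
    constructor
    · rintro ⟨x, hx, rfl⟩
      obtain ⟨z, hz, rfl⟩ := Finset.mem_image.1 (Finset.mem_coe.1 hx)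
      rw [hg z hz]
      exact hz
    · intro hy
      exact ⟨g y, Finset.mem_coe.2 (Finset.mem_image_of_mem g hy), hg y hy⟩
  have hsplit : ∀ x ∈ N, ∃ z ∈ S, x - z ∈ N ⊓ K := by
    intro x hx
    have hx' : K.mkQ x ∈ S.map K.mkQ := hSmap ▸ Submodule.mem_map_of_mem hx
    obtain ⟨z, hz, hzx⟩ := hx'
    exact ⟨z, hz, N.sub_mem hx (hSN hz), (Submodule.Quotient.eq K).1 hzx.symm⟩
  obtain ⟨u, hu⟩ := hN
  have huN : ∀ x ∈ u, x ∈ N := fun x hx => hu ▸ Submodule.subset_span hx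
  choose! f hfS hf using hsplit
  obtain ⟨v, hvcard, hv⟩ := hb (Submodule.span R ((u.image fun x => x - f x : Finset M) : Set M))
    ⟨_, rfl⟩ (by
      rw [Submodule.span_le]
      intro x hx
      obtain ⟨y, hy, rfl⟩ := Finset.mem_image.1 (Finset.mem_coe.1 hx)
      exact hf y (huN y hy))
  refine ⟨t.image g ∪ v, (Finset.card_union_le _ _).trans
    (add_le_add (Finset.card_image_le.trans htcard) hvcard), ?_⟩
  rw [Finset.coe_union, Submodule.span_union, hv, ← hS]
  apply le_antisymm
  · refine sup_le hSN (Submodule.span_le.2 fun x hx => ?_)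
    obtain ⟨y, hy, rfl⟩ := Finset.mem_image.1 (Finset.mem_coe.1 hx)
    exact (hf y (huN y hy)).1
  · rw [← hu, Submodule.span_le]
    intro x hx
    rw [← add_sub_cancel (f x) x]
    exact Submodule.add_mem_sup (hfS x (huN x hx))
      (Submodule.subset_span (Finset.mem_coe.2 (Finset.mem_image_of_mem _ hx)))

/-- A submodule maximal among those containing `L` and disjoint from `U`. -/
theorem Submodule.exists_le_maximal_disjoint {R : Type u} [Ring R] {M : Type v} [AddCommGroup M]
    [Module R M] {L U : Submodule R M} (h : Disjoint U L) :
    ∃ K, L ≤ K ∧ Maximal (fun K => Disjoint U K) K := by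
  refine zorn_le_nonempty₀ {K : Submodule R M | Disjoint U K} (fun c hc hchain y hy => ?_) L h
  exact ⟨sSup c, hchain.directedOn.disjoint_sSup_right.2 fun K hK => hc hK, fun K hK => le_sSup hK⟩

/-- Every nonzero submodule of the quotient of `M` by a maximal submodule disjoint from a uniform
submodule is uniform. -/
theorem IsUniformSubmodule.isUniformModule_of_maximal_disjoint {R : Type u} [Ring R] {M : Type v}
    [AddCommGroup M] [Module R M] {U K : Submodule R M} (hU : IsUniformSubmodule U)
    (hK : Maximal (fun K => Disjoint U K) K) {W : Submodule R (M ⧸ K)} (hW : W ≠ ⊥) :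
    IsUniformModule R W := by
  have key : ∀ A : Submodule R W, A ≠ ⊥ →
      U ⊓ (A.map W.subtype).comap K.mkQ ≠ ⊥ := by
    intro A hA hbot
    have hle : K ≤ (A.map W.subtype).comap K.mkQ := by
      intro x hx
      have : K.mkQ x = 0 := (Submodule.Quotient.mk_eq_zero K).2 hx
      rw [Submodule.mem_comap, this]
      exact zero_mem _
    have hge := hK.2 (disjoint_iff.2 hbot) hle
    apply hA
    rw [Submodule.eq_bot_iff]
    intro w hw
    obtain ⟨x, hx⟩ := K.mkQ_surjective (w : M ⧸ K)
    have hxK : x ∈ K := hge (by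
      rw [Submodule.mem_comap, hx]
      exact Submodule.mem_map_of_mem hw)
    apply Subtype.ext
    rw [← hx]
    exact (Submodule.Quotient.mk_eq_zero K).2 hxK
  refine ⟨?_, fun A B hA hB hAB => ?_⟩
  · obtain ⟨x, hxW, hx⟩ := W.ne_bot_iff.1 hW
    exact ⟨⟨x, hxW⟩, fun h => hx (congrArg Subtype.val h)⟩
  · refine hU.2 _ _ inf_le_left inf_le_left (key A hA) (key B hB) ?_
    rw [← inf_inf_distrib_left, ← Submodule.comap_inf,
      ← Submodule.map_inf _ W.injective_subtype, hAB, Submodule.map_bot]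
    rw [← LinearMap.ker, Submodule.ker_mkQ]
    exact hK.1.eq_bot

/-- over a chain ring, if every finitely generated uniform module is generated by
at most `n` elements, then every finitely generated module of Goldie dimension `p` is generated
by at most `n * p` elements. -/
theorem stmt8 (R : Type u) [CommRing R] [IsLocalRing R]
    (hchain : ∀ I J : Ideal R, I ≤ J ∨ J ≤ I)
    (n : ℕ) (hn : 0 < n)
    (hgen : ∀ (M : Type u) [AddCommGroup M] [Module R M],
      Module.Finite R M → IsUniformModule R M → GenLE R M n)
    (M : Type u) [AddCommGroup M] [Module R M] [Module.Finite R M]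
    (p : ℕ)
    (hGd : ∃ f : Fin p → Submodule R M,
      (∀ i, IsUniformSubmodule (f i)) ∧
      (∀ i, f i ⊓ (⨆ j : {j : Fin p // j ≠ i}, f j.1) = ⊥) ∧
      IsEssentialSubmodule (⨆ i, f i)) :
    GenLE R M (n * p) := by
  classical
  obtain ⟨f, hf, hind, hess⟩ := hGd
  have hmax : ∀ i, ∃ K, (⨆ j : {j : Fin p // j ≠ i}, f j.1) ≤ K ∧
      Maximal (fun K => Disjoint (f i) K) K :=
    fun i => Submodule.exists_le_maximal_disjoint (disjoint_iff.2 (hind i))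
  choose K hle hK using hmax
  have hfK : ∀ i j, j ≠ i → f j ≤ K i := fun i j hji =>
    (le_iSup (fun j : {j : Fin p // j ≠ i} => f j.1) ⟨j, hji⟩).trans (hle i)
  have hinf : ⨅ i, K i = ⊥ := by
    apply hess
    rw [Submodule.eq_bot_iff]
    rintro x ⟨hxK, hxf⟩
    obtain ⟨y, hy, rfl⟩ := (Submodule.mem_iSup_iff_exists_finsupp f x).1 hxf
    rw [Finsupp.sum_fintype y (fun _ m => m) fun _ => rfl] at hxK ⊢
    refine Finset.sum_eq_zero fun i _ => ?_
    have hyi : y i ∈ K i := by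
      have hx := (Submodule.mem_iInf K).1 hxK i
      rw [← Finset.add_sum_erase _ _ (Finset.mem_univ i)] at hx
      refine (Submodule.add_mem_iff_left _ (Submodule.sum_mem _ fun j hj => ?_)).1 hx
      exact hfK i j (Finset.ne_of_mem_erase hj) (hy j)
    exact Submodule.disjoint_def.1 (hK i).1 _ (hy i) hyi
  have main : ∀ (s : Finset (Fin p)) (N : Submodule R M), N.FG → N ⊓ (⨅ i ∈ s, K i) = ⊥ →
      ∃ t : Finset M, t.card ≤ n * s.card ∧ Submodule.span R (t : Set M) = N := by
    intro s
    induction s using Finset.induction_on with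
    | empty =>
      intro N _ hbot
      exact ⟨∅, by simp, by simpa using hbot.symm⟩
    | insert i s his ih =>
      intro N hN hbot
      rw [Finset.card_insert_of_notMem his, Nat.mul_add, Nat.mul_one, Nat.add_comm]
      refine hN.exists_finset_card_le_add (K i) ?_ fun L hL hLN => ih L hL ?_
      · by_cases hW : N.map (K i).mkQ = ⊥
        · exact ⟨∅, by simp, by simpa using hW.symm⟩
        · have hfin : Module.Finite R (N.map (K i).mkQ) := Module.Finite.iff_fg.2 (hN.map _)
          obtain ⟨t, htcard, ht⟩ := hgen _ hfin ((hf i).isUniformModule_of_maximal_disjoint (hK i) hW)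
          refine ⟨t.image Subtype.val, Finset.card_image_le.trans htcard, ?_⟩
          have := congrArg (Submodule.map (N.map (K i).mkQ).subtype) ht
          rw [Submodule.map_span, Submodule.map_top, Submodule.range_subtype] at this
          rw [Finset.coe_image]
          exact this
      · rw [Finset.iInf_insert, ← inf_assoc] at hbot
        exact le_bot_iff.1 ((inf_le_inf_right _ hLN).trans hbot.le)
  obtain ⟨t, htcard, ht⟩ := main Finset.univ ⊤ Module.Finite.fg_top (by simpa using hinf)
  exact ⟨t, by simpa using htcard, ht⟩
end
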